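/- arXiv:1611.06116 — 3 statements merged into one kernel-verified Lean document; each statement's English description precedes it below -/
import Mathlib

section
/- Let n be a positive integer. Then the number of (x,y,z) ∈ ℤ³ with x²+4y²+12z² = 24n+1, x ≡ 3 (mod 12), y − z ≡ 0 (mod 6), and y + z ≡ 2 (mod 6) is zero if and only if 24n+1 = W² for some positive integer W all of whose prime divisors are congruent to 1 modulo 3. -/
open scoped NumberTheorySymbols Quaternion

/-- Values of the norm form of the Eisenstein integers. -/
def IsEisensteinNorm (v : ℤ) : Prop := ∃ a b : ℤ, v = a ^ 2 - a * b + b ^ 2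

theorem IsEisensteinNorm.mul {u v : ℤ} (hu : IsEisensteinNorm u) (hv : IsEisensteinNorm v) :
    IsEisensteinNorm (u * v) := by
  obtain ⟨a, b, rfl⟩ := hu
  obtain ⟨c, d, rfl⟩ := hv
  exact ⟨a * c - b * d, a * d + b * c - b * d, by ring⟩

theorem IsEisensteinNorm.nonneg {v : ℤ} (h : IsEisensteinNorm v) : 0 ≤ v := by
  obtain ⟨a, b, rfl⟩ := h
  nlinarith [sq_nonneg (2 * a - b), sq_nonneg b]

theorem jacobiSym_neg_three {b : ℕ} (hb : Odd b) : J(-3 | b) = J(b | 3) := by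
  rw [jacobiSym.neg 3 hb]
  have h := Nat.odd_mod_four_iff.mp (Nat.odd_iff.mp hb)
  rcases h with h | h
  · rw [ZMod.χ₄_nat_one_mod_four h, one_mul]
    exact_mod_cast jacobiSym.quadratic_reciprocity_one_mod_four' (a := 3) (by decide) h
  · rw [ZMod.χ₄_nat_three_mod_four h]
    have := jacobiSym.quadratic_reciprocity_three_mod_four (a := 3) (by decide) h
    push_cast at this
    rw [this]; ring

theorem jacobiSym_three_of_mod_one {b : ℕ} (hb : b % 3 = 1) : J(b | 3) = 1 := by
  rw [jacobiSym.mod_left, show ((b : ℤ) % ((3 : ℕ) : ℤ)) = 1 by omega, jacobiSym.one_left]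

theorem jacobiSym_three_of_mod_two {b : ℕ} (hb : b % 3 = 2) : J(b | 3) = -1 := by
  rw [jacobiSym.mod_left, show ((b : ℤ) % ((3 : ℕ) : ℤ)) = 2 by omega]
  norm_num

/-- A prime `p ≡ 2 (mod 3)` is inert in the Eisenstein integers. -/
theorem dvd_of_dvd_eisensteinNorm {p : ℕ} (hp : p.Prime) (h3 : p % 3 = 2) {a b : ℤ}
    (h : (p : ℤ) ∣ a ^ 2 - a * b + b ^ 2) : (p : ℤ) ∣ a ∧ (p : ℤ) ∣ b := by
  have := Fact.mk hp
  rcases hp.eq_two_or_odd' with rfl | hodd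
  · have h2 : (a ^ 2 - a * b + b ^ 2) % 2 = 0 := Int.emod_eq_zero_of_dvd h
    rcases Int.emod_two_eq_zero_or_one a with ha | ha <;>
      rcases Int.emod_two_eq_zero_or_one b with hb | hb <;>
      simp [pow_two, Int.add_emod, Int.sub_emod, Int.mul_emod, ha, hb] at h2
    exact ⟨Int.dvd_of_emod_eq_zero ha, Int.dvd_of_emod_eq_zero hb⟩
  · have hJ : J(-3 | p) = -1 := by
      rw [jacobiSym_neg_three hodd, jacobiSym_three_of_mod_two h3]
    have h4 : (p : ℤ) ∣ (2 * a - b) ^ 2 - -3 * b ^ 2 := by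
      rw [show (2 * a - b) ^ 2 - -3 * b ^ 2 = 4 * (a ^ 2 - a * b + b ^ 2) by ring]
      exact h.mul_left 4
    obtain ⟨h5, h6⟩ := jacobiSym.prime_dvd_of_eq_neg_one hJ h4
    refine ⟨?_, h6⟩
    have h7 : (p : ℤ) ∣ 2 * a := by simpa using dvd_add h5 h6
    refine (Int.Prime.dvd_mul' hp h7).resolve_left fun h2 => ?_
    have : p ∣ 2 := by exact_mod_cast h2
    rw [Nat.prime_dvd_prime_iff_eq hp Nat.prime_two] at this
    subst this; exact absurd hodd (by decide)

theorem even_padicValInt_of_anisotropic {p : ℕ} (hp : p.Prime) {A B C : ℤ}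
    (h : ∀ x y : ℤ, (p : ℤ) ∣ A * x ^ 2 + B * x * y + C * y ^ 2 → (p : ℤ) ∣ x ∧ (p : ℤ) ∣ y)
    (x y : ℤ) : Even (padicValInt p (A * x ^ 2 + B * x * y + C * y ^ 2)) := by
  have := Fact.mk hp
  induction hk : padicValInt p (A * x ^ 2 + B * x * y + C * y ^ 2) using Nat.strong_induction_on
    generalizing x y with
  | _ k ih =>
    set v := A * x ^ 2 + B * x * y + C * y ^ 2 with hv
    rw [← hk]
    by_cases h0 : v = 0
    · simp [h0]
    by_cases hd : (p : ℤ) ∣ v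
    · obtain ⟨⟨x', rfl⟩, ⟨y', rfl⟩⟩ := h x y hd
      have hv' : v = p * (p * (A * x' ^ 2 + B * x' * y' + C * y' ^ 2)) := by rw [hv]; ring
      set w := A * x' ^ 2 + B * x' * y' + C * y' ^ 2 with hw
      have hp0 : (p : ℤ) ≠ 0 := by exact_mod_cast hp.ne_zero
      have hw0 : w ≠ 0 := by rintro h; apply h0; rw [hv', h]; ring
      have e : padicValInt p v = padicValInt p w + 2 := by
        rw [hv', padicValInt.mul hp0 (mul_ne_zero hp0 hw0), padicValInt.mul hp0 hw0,
          padicValInt_self]; ring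
      rw [e]
      exact (ih (padicValInt p w) (by rw [← hk, e]; omega) x' y' rfl).add even_two
    · rw [padicValInt.eq_zero_of_not_dvd hd]; exact Even.zero

theorem IsEisensteinNorm.even_padicValInt {v : ℤ} (hv : IsEisensteinNorm v) {p : ℕ}
    (hp : p.Prime) (h3 : p % 3 = 2) : Even (padicValInt p v) := by
  obtain ⟨a, b, rfl⟩ := hv
  have := even_padicValInt_of_anisotropic hp (A := 1) (B := -1) (C := 1)
    (fun x y h => dvd_of_dvd_eisensteinNorm hp h3 (by convert h using 1; ring)) a b
  convert this using 2; ring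

theorem exists_centered_residue (a : ℤ) {m : ℤ} (hm : 0 < m) :
    ∃ a' u : ℤ, a = a' + m * u ∧ 2 * a' ≤ m ∧ -m ≤ 2 * a' := by
  have h1 := Int.emod_add_mul_ediv (2 * a + m) (2 * m)
  have h2 := Int.emod_nonneg (2 * a + m) (by omega : 2 * m ≠ 0)
  have h3 := Int.emod_lt_of_pos (2 * a + m) (by omega : 0 < 2 * m)
  refine ⟨a - m * ((2 * a + m) / (2 * m)), (2 * a + m) / (2 * m), by ring, ?_, ?_⟩ <;> nlinarith

theorem isEisensteinNorm_of_mul_prime {p : ℕ} (hp : p.Prime) (m : ℕ) (hm : 0 < m) (hmp : m < p)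
    (h : IsEisensteinNorm (m * p)) : IsEisensteinNorm p := by
  induction m using Nat.strong_induction_on with
  | _ m ih =>
    rcases Nat.eq_or_lt_of_le hm with h1 | h1
    · subst h1; simpa using h
    obtain ⟨a, b, hab⟩ := h
    have hm0 : (0 : ℤ) < m := by exact_mod_cast hm
    obtain ⟨a', u, ha1, ha2, ha3⟩ := exists_centered_residue a hm0
    obtain ⟨b', w, hb1, hb2, hb3⟩ := exists_centered_residue b hm0
    subst ha1 hb1
    obtain ⟨k, hk⟩ : (m : ℤ) ∣ a' ^ 2 - a' * b' + b' ^ 2 :=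
      ⟨p - (2 * a' * u + m * u ^ 2 - a' * w - u * b' - m * u * w + 2 * b' * w + m * w ^ 2), by
        linear_combination -hab⟩
    have hN : 0 ≤ a' ^ 2 - a' * b' + b' ^ 2 := IsEisensteinNorm.nonneg ⟨a', b', rfl⟩
    have hlt : a' ^ 2 - a' * b' + b' ^ 2 < m ^ 2 := by
      nlinarith [mul_nonneg (sub_nonneg.2 ha2) (by linarith : (0 : ℤ) ≤ m + 2 * a'),
        mul_nonneg (sub_nonneg.2 hb2) (by linarith : (0 : ℤ) ≤ m + 2 * b'),
        sq_nonneg (a' + b'), sq_nonneg (a' - b')]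
    have hk0 : 0 ≤ k := by by_contra! hc; nlinarith
    have hkm : k < m := by by_contra! hc; nlinarith
    rcases hk0.eq_or_lt with hk1 | hk1
    · exfalso
      have hz : a' ^ 2 - a' * b' + b' ^ 2 = 0 := by rw [hk, ← hk1, mul_zero]
      have hb0 : b' = 0 := by nlinarith [sq_nonneg (2 * a' - b'), sq_nonneg b']
      subst hb0
      have ha0 : a' = 0 := by nlinarith
      subst ha0
      have hd : (m : ℤ) ∣ p := ⟨u ^ 2 - u * w + w ^ 2, by
        apply mul_left_cancel₀ hm0.ne'
        linear_combination hab⟩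
      have := (Nat.dvd_prime hp).1 (Int.natCast_dvd_natCast.1 hd)
      omega
    · lift k to ℕ using hk0
      refine ih k (by exact_mod_cast hkm) (by exact_mod_cast hk1)
        (by have : k < m := by exact_mod_cast hkm
            omega) ?_
      refine ⟨k + (a' * u + b' * w - u * b'), (a' * w - b' * u), ?_⟩
      apply mul_left_cancel₀ (pow_ne_zero 2 hm0.ne')
      linear_combination (m * k : ℤ) * hab + (-((a' + m * u) ^ 2 - (a' + m * u) * (b' + m * w) +
        (b' + m * w) ^ 2) + (a' ^ 2 - a' * b' + b' ^ 2) + m * k +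
        2 * m * (a' * u + b' * w - u * b') - m * (a' * w - b' * u)) * hk

theorem isEisensteinNorm_prime {p : ℕ} (hp : p.Prime) (h3 : p % 3 = 1) : IsEisensteinNorm p := by
  have := Fact.mk hp
  have hodd : Odd p := hp.odd_of_ne_two (by rintro rfl; simp at h3)
  have hJ : J(-3 | p) = 1 := by rw [jacobiSym_neg_three hodd, jacobiSym_three_of_mod_one h3]
  obtain ⟨s, hs⟩ := ZMod.isSquare_of_jacobiSym_eq_one hJ
  obtain ⟨t, rfl⟩ := ZMod.intCast_surjective s
  have hd : (p : ℤ) ∣ t ^ 2 + 3 := by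
    rw [← ZMod.intCast_zmod_eq_zero_iff_dvd]
    push_cast at hs ⊢
    rw [sq, ← hs]; ring
  have hp0 : (0 : ℤ) < p := by exact_mod_cast hp.pos
  obtain ⟨c, hc⟩ := hodd
  have hcp : (p : ℤ) = 2 * c + 1 := by exact_mod_cast hc
  obtain ⟨a, u, ha1, ha2, ha3⟩ := exists_centered_residue ((t + 1) * (c + 1)) hp0
  have hda : (p : ℤ) ∣ a ^ 2 - a * 1 + 1 ^ 2 := by
    have h4 : (p : ℤ) ∣ 4 * (a ^ 2 - a * 1 + 1 ^ 2) := by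
      have e : 2 * a - 1 = t + p * (t + 1 - 2 * u) := by rw [hcp] at ha1 ⊢; linear_combination -2 * ha1
      have : 4 * (a ^ 2 - a * 1 + 1 ^ 2) = (t ^ 2 + 3) +
          p * ((t + 1 - 2 * u) * (2 * t + p * (t + 1 - 2 * u))) := by
        linear_combination (2 * a - 1 + t + p * (t + 1 - 2 * u)) * e
      rw [this]
      exact dvd_add hd (dvd_mul_right _ _)
    refine (Int.isCoprime_iff_gcd_eq_one.2 ?_).dvd_of_dvd_mul_left h4
    have : Nat.Coprime p (2 ^ 2) := Nat.Coprime.pow_right 2 (by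
      rw [Nat.coprime_comm, Nat.coprime_two_left]; exact ⟨c, hc⟩)
    exact this
  obtain ⟨m, hm⟩ := hda
  have hp2 : (2 : ℤ) ≤ p := by exact_mod_cast hp.two_le
  have hm0 : 0 < m := by by_contra! h; nlinarith [sq_nonneg (2 * a - 1)]
  have hmp : m < p := by
    by_contra! h
    nlinarith [mul_nonneg (sub_nonneg.2 ha2) (by linarith : (0 : ℤ) ≤ p + 2 * a)]
  lift m to ℕ using hm0.le
  exact isEisensteinNorm_of_mul_prime hp m (by exact_mod_cast hm0) (by exact_mod_cast hmp)
    ⟨a, 1, by rw [hm]; ring⟩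

theorem isEisensteinNorm_of_even_padicValNat (v : ℕ)
    (h : ∀ p : ℕ, p.Prime → p % 3 = 2 → Even (padicValNat p v)) : IsEisensteinNorm v := by
  induction v using Nat.strong_induction_on with
  | _ v ih =>
    rcases Nat.eq_zero_or_pos v with rfl | hv
    · exact ⟨0, 0, by simp⟩
    by_cases h1 : v = 1
    · subst h1; exact ⟨1, 0, by simp⟩
    obtain ⟨p, hp, w, rfl⟩ := Nat.exists_prime_and_dvd h1
    have := Fact.mk hp
    have hw : w ≠ 0 := by rintro rfl; simp at hv
    have split (l : ℕ) (u : ℕ) (hl : l.Prime) (hu : u ≠ 0) (hlp : l ≠ p) :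
        padicValNat l (p * u) = padicValNat l u := by
      have := Fact.mk hl
      rw [padicValNat.mul hp.ne_zero hu, padicValNat_primes hlp, zero_add]
    rcases (by omega : p % 3 = 0 ∨ p % 3 = 1 ∨ p % 3 = 2) with h3 | h3 | h3
    · have : p = 3 := ((Nat.prime_dvd_prime_iff_eq Nat.prime_three hp).1
        (Nat.dvd_of_mod_eq_zero h3)).symm
      push_cast
      refine IsEisensteinNorm.mul ⟨2, 1, by rw [this]; norm_num⟩ (ih w (by nlinarith [hp.two_le])
        fun l hl hl3 => ?_)
      rw [← split l w hl hw (by rintro rfl; omega)]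
      exact h l hl hl3
    · push_cast
      refine (isEisensteinNorm_prime hp h3).mul (ih w (by nlinarith [hp.two_le, hw.bot_lt])
        fun l hl hl3 => ?_)
      rw [← split l w hl hw (by rintro rfl; omega)]
      exact h l hl hl3
    · have he := h p hp h3
      rw [padicValNat.mul hp.ne_zero hw, padicValNat_self] at he
      obtain ⟨u, rfl⟩ : p ∣ w := by
        by_contra hd
        rw [padicValNat.eq_zero_of_not_dvd hd] at he
        exact absurd he (by decide)
      have hu : u ≠ 0 := by rintro rfl; simp at hw
      have hpu : u < p * u := by nlinarith [hp.two_le, hu.bot_lt]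
      have := ih u (by nlinarith [hp.two_le, hu.bot_lt]) fun l hl hl3 => by
        by_cases hlp : l = p
        · subst hlp
          rw [padicValNat.mul hp.ne_zero hu, padicValNat_self] at he
          rw [show 1 + (1 + padicValNat l u) = padicValNat l u + 2 by ring] at he
          exact (Nat.even_add.1 he).2 even_two
        · rw [← split l u hl hu hlp, ← split l _ hl hw hlp]
          exact h l hl hl3
      have e : ((p * (p * u) : ℕ) : ℤ) = (p ^ 2) * u := by push_cast; ring
      rw [e]
      exact IsEisensteinNorm.mul ⟨p, 0, by ring⟩ this

/-- The maximal order `ℤ[ω] + ℤ[ω]j`, with `j ^ 2 = -1`, of the quaternion algebra of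
discriminant `3`. -/
abbrev HurwitzThree := ℍ[ℤ,-1,-1,-1]

namespace HurwitzThree

/-- The reduced norm. -/
def nrd (x : HurwitzThree) : ℤ :=
  (x.re ^ 2 - x.re * x.imI + x.imI ^ 2) + (x.imJ ^ 2 - x.imJ * x.imK + x.imK ^ 2)

/-- The reduced trace. -/
def trd (x : HurwitzThree) : ℤ := 2 * x.re - x.imI

theorem nrd_mul (x y : HurwitzThree) : nrd (x * y) = nrd x * nrd y := by
  simp only [nrd, QuaternionAlgebra.re_mul, QuaternionAlgebra.imI_mul, QuaternionAlgebra.imJ_mul,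
    QuaternionAlgebra.imK_mul]
  ring

theorem nrd_star (x : HurwitzThree) : nrd (star x) = nrd x := by
  simp only [nrd, QuaternionAlgebra.re_star, QuaternionAlgebra.imI_star,
    QuaternionAlgebra.imJ_star, QuaternionAlgebra.imK_star]
  ring

theorem nrd_intCast (m : ℤ) : nrd (m : HurwitzThree) = m ^ 2 := by
  simp [nrd]

theorem mul_star_eq (x : HurwitzThree) : x * star x = (nrd x : HurwitzThree) := by
  generalize hn : nrd x = n
  unfold nrd at hn
  ext <;> simp
  · linear_combination hn
  all_goals ring

theorem star_mul_eq (x : HurwitzThree) : star x * x = (nrd x : HurwitzThree) := by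
  generalize hn : nrd x = n
  unfold nrd at hn
  ext <;> simp
  · linear_combination hn
  all_goals ring

theorem add_star_eq (x : HurwitzThree) : x + star x = (trd x : HurwitzThree) := by
  generalize hn : trd x = n
  unfold trd at hn
  ext <;> simp
  linear_combination hn

theorem sq_eq (x : HurwitzThree) : x * x = (trd x : HurwitzThree) * x - (nrd x : HurwitzThree) := by
  rw [← add_star_eq, ← star_mul_eq]; noncomm_ring

theorem nrd_nonneg (x : HurwitzThree) : 0 ≤ nrd x := by
  have h1 := IsEisensteinNorm.nonneg ⟨x.re, x.imI, rfl⟩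
  have h2 := IsEisensteinNorm.nonneg ⟨x.imJ, x.imK, rfl⟩
  unfold nrd; linarith

theorem nrd_eq_zero {x : HurwitzThree} : nrd x = 0 ↔ x = 0 := by
  refine ⟨fun h => ?_, fun h => by simp [h, nrd]⟩
  unfold nrd at h
  have hI : x.imI = 0 := by
    nlinarith [sq_nonneg (2 * x.re - x.imI), sq_nonneg (2 * x.imJ - x.imK), sq_nonneg x.imI,
      sq_nonneg x.imK]
  have hK : x.imK = 0 := by
    nlinarith [sq_nonneg (2 * x.re - x.imI), sq_nonneg (2 * x.imJ - x.imK), sq_nonneg x.imI,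
      sq_nonneg x.imK]
  rw [hI, hK] at h
  have hR : x.re = 0 := by nlinarith [sq_nonneg x.re, sq_nonneg x.imJ]
  have hJ : x.imJ = 0 := by nlinarith [sq_nonneg x.re, sq_nonneg x.imJ]
  ext <;> simpa

theorem dvd_nrd_add_mul {q : ℤ} {x : HurwitzThree} (h : q ∣ nrd x) (y : HurwitzThree) :
    q ∣ nrd (y * (q : HurwitzThree) + x) := by
  obtain ⟨k, hk⟩ := h
  unfold nrd at hk
  refine ⟨k + q * nrd y + (2 * x.re * y.re - x.re * y.imI - y.re * x.imI + 2 * x.imI * y.imI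
    + 2 * x.imJ * y.imJ - x.imJ * y.imK - y.imJ * x.imK + 2 * x.imK * y.imK), ?_⟩
  simp [nrd]
  linear_combination hk

theorem exists_eisenstein_residue (c d : ℤ) {m : ℤ} (hm : 0 < m) :
    ∃ u w : ℤ, 16 * ((c - m * u) ^ 2 - (c - m * u) * (d - m * w) + (d - m * w) ^ 2) ≤
      7 * m ^ 2 := by
  obtain ⟨b, w, hb, hb1, hb2⟩ := exists_centered_residue d hm
  obtain ⟨r, u, hr, hr1, hr2⟩ := exists_centered_residue (2 * c - b) (by linarith : 0 < 2 * m)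
  refine ⟨u, w, ?_⟩
  have e : d - m * w = b := by linarith
  have e2 : 2 * (c - m * u) - b = r := by linarith
  rw [e]
  nlinarith [mul_nonneg (sub_nonneg.2 hb1) (by linarith : (0 : ℤ) ≤ m + 2 * b),
    mul_nonneg (sub_nonneg.2 hr1) (by linarith : (0 : ℤ) ≤ 2 * m + 2 * r)]

theorem exists_nrd_sub_mul_lt (x : HurwitzThree) {y : HurwitzThree} (hy : y ≠ 0) :
    ∃ k : HurwitzThree, nrd (x - k * y) < nrd y := by
  have hn : 0 < nrd y := lt_of_le_of_ne (nrd_nonneg y) fun h => hy (nrd_eq_zero.1 h.symm)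
  obtain ⟨u, w, h1⟩ := exists_eisenstein_residue (x * star y).re (x * star y).imI hn
  obtain ⟨s, t, h2⟩ := exists_eisenstein_residue (x * star y).imJ (x * star y).imK hn
  refine ⟨⟨u, w, s, t⟩, ?_⟩
  set k : HurwitzThree := ⟨u, w, s, t⟩ with hk
  have h3 : nrd (x - k * y) * nrd y = nrd (x * star y - k * (nrd y : HurwitzThree)) := by
    rw [← nrd_star y, ← nrd_mul, nrd_star, sub_mul, mul_assoc, mul_star_eq]
  have h4 : 16 * nrd (x * star y - k * (nrd y : HurwitzThree)) ≤ 14 * nrd y ^ 2 := by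
    generalize x * star y = z at *
    generalize nrd y = m at *
    simp only [nrd, hk, QuaternionAlgebra.re_sub, QuaternionAlgebra.imI_sub,
      QuaternionAlgebra.imJ_sub, QuaternionAlgebra.imK_sub, QuaternionAlgebra.re_mul,
      QuaternionAlgebra.imI_mul, QuaternionAlgebra.imJ_mul,
      QuaternionAlgebra.imK_mul, QuaternionAlgebra.re_intCast, QuaternionAlgebra.imI_intCast,
      QuaternionAlgebra.imJ_intCast, QuaternionAlgebra.imK_intCast, Int.cast_id]
    linarith
  by_contra! hc
  nlinarith

/-- The left ideal generated by a prime `q` and an element of norm divisible by `q` is generated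
by an element of norm `q`. -/
theorem exists_generator {q : ℕ} (hq : q.Prime) {x : HurwitzThree} (hx : (q : ℤ) ∣ nrd x)
    (hx' : ∀ y : HurwitzThree, x ≠ y * (q : ℤ)) :
    ∃ p a b k : HurwitzThree, nrd p = q ∧ p = a * (q : ℤ) + b * x ∧ x = k * p := by
  let S : Set ℕ := {n | ∃ a b : HurwitzThree, a * (q : ℤ) + b * x ≠ 0 ∧
    n = (nrd (a * (q : ℤ) + b * x)).toNat}
  have hq0 : (q : ℤ) ≠ 0 := by exact_mod_cast hq.ne_zero
  have hS : S.Nonempty := by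
    refine ⟨_, 1, 0, ?_, rfl⟩
    rw [Ne, ← nrd_eq_zero, zero_mul, add_zero, one_mul, nrd_intCast]
    exact pow_ne_zero 2 hq0
  obtain ⟨a, b, h0, hmin⟩ := Nat.sInf_mem hS
  set p := a * ((q : ℤ) : HurwitzThree) + b * x with hp
  have hgen (c d : HurwitzThree) : ∃ k, c * (q : ℤ) + d * x = k * p := by
    obtain ⟨k, hk⟩ := exists_nrd_sub_mul_lt (c * (q : ℤ) + d * x) h0
    refine ⟨k, ?_⟩
    by_contra hne
    have he : c * (q : ℤ) + d * x - k * p = (c - k * a) * (q : ℤ) + (d - k * b) * x := by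
      rw [hp]; noncomm_ring
    have : sInf S ≤ (nrd (c * (q : ℤ) + d * x - k * p)).toNat :=
      Nat.sInf_le ⟨c - k * a, d - k * b, by rw [← he]; exact sub_ne_zero.2 hne, by rw [he]⟩
    rw [hmin] at this
    have h1 := nrd_nonneg p
    have h2 := nrd_nonneg (c * (q : ℤ) + d * x - k * p)
    omega
  obtain ⟨k, hk⟩ := hgen 0 1
  obtain ⟨l, hl⟩ := hgen 1 0
  simp only [zero_mul, one_mul, zero_add, add_zero] at hk hl
  refine ⟨p, a, b, k, ?_, hp, hk⟩
  have hdvd : (q : ℤ) ∣ nrd p := dvd_nrd_add_mul (by rw [nrd_mul]; exact hx.mul_left _) a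
  have hmul : (q : ℤ) ^ 2 = nrd l * nrd p := by rw [← nrd_intCast, hl, nrd_mul]
  obtain ⟨m, hm⟩ := hdvd
  have hlm : (q : ℤ) = nrd l * m := by
    apply mul_left_cancel₀ hq0
    rw [← sq, hmul, hm]; ring
  have hl0 := nrd_nonneg l
  have hqpos : (0 : ℤ) < q := by exact_mod_cast hq.pos
  lift nrd l to ℕ using hl0 with L hL
  have hm0 : 0 ≤ m := by by_contra! h; nlinarith
  lift m to ℕ using hm0
  have hlm' : q = L * m := by exact_mod_cast hlm
  rcases (Nat.dvd_prime hq).1 ⟨m, hlm'⟩ with h | h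
  · exfalso
    refine hx' (k * star l) ?_
    rw [hl, mul_assoc, ← mul_assoc (star l), star_mul_eq, ← hL, h]
    simpa using hk
  · have : m = 1 := by
      rw [h] at hlm'
      exact Nat.eq_of_mul_eq_mul_left hq.pos (by linarith)
    rw [hm, this]; simp

end HurwitzThree

namespace HurwitzThree

theorem imI_eq_zero_of_conj_mod_three : ∀ t u v c₀ c₁ d₀ d₁ : ZMod 3, t ≠ 0 →
    c₀ ^ 2 - c₀ * c₁ + c₁ ^ 2 + (d₀ ^ 2 - d₀ * d₁ + d₁ ^ 2) = 2 →
    c₀ * (2 + 2 * t) - c₁ * t =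
      (2 + 2 * u) * c₀ - u * c₁ - v * d₀ + v * d₁ + v * d₁ →
    d₀ * (2 + 2 * t) - d₀ * t + d₁ * t =
      (2 + 2 * u) * d₀ - u * d₁ + v * c₀ - v * c₁ - v * c₁ →
    c₀ * t + c₁ * (2 + 2 * t) - c₁ * t =
      (2 + 2 * u) * c₁ + u * c₀ - u * c₁ + v * d₁ + v * d₀ →
    -(d₀ * t) + d₁ * (2 + 2 * t) =
      (2 + 2 * u) * d₁ + u * d₀ - u * d₁ - v * c₁ - v * c₀ → u = 0 := by
  decide

/-- Conjugation by an element of norm `q ≡ 2 (mod 3)` interchanges the two classes of elements of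
trace `1` and norm `N ≡ 1 (mod 9)`. -/
theorem exists_three_dvd_imI {q : ℕ} (hq : q.Prime) (hq3 : q % 3 = 2) {x : HurwitzThree}
    (htr : trd x = 1) (hN : nrd x % 3 = 1) (hI : ¬ 3 ∣ x.imI) (hJ : 3 ∣ x.imJ) (hK : 3 ∣ x.imK)
    {s : ℤ} (hs : (q : ℤ) ∣ s ^ 2 - s + nrd x) (hdisc : ¬ (q : ℤ) ∣ 4 * nrd x - 1) :
    ∃ y : HurwitzThree, trd y = 1 ∧ nrd y = nrd x ∧ 3 ∣ y.imI := by
  set z : HurwitzThree := x - (s : HurwitzThree) with hz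
  have hznrd : nrd z = s ^ 2 - s + nrd x := by
    unfold trd at htr
    simp [hz, nrd]
    linear_combination -s * htr
  have hzq : ∀ y : HurwitzThree, z ≠ y * ((q : ℤ) : HurwitzThree) := by
    intro y hy
    apply hdisc
    have h1 : (q : ℤ) ∣ nrd z := hznrd ▸ hs
    have h2 : trd z = trd y * q := by
      rw [hy]; simp [trd]; ring
    have h3 : trd z = 1 - 2 * s := by
      unfold trd at htr
      simp [hz, trd]
      linear_combination htr
    have h4 : 4 * nrd x - 1 = 4 * nrd z - (trd y * q) * (trd y * q) := by
      rw [← h2, h3, hznrd]; ring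
    rw [h4]
    exact dvd_sub (h1.mul_left 4) ((dvd_mul_left _ _).mul_left _)
  obtain ⟨p, a, b, k, hpq, hp, hzk⟩ := exists_generator hq (hznrd ▸ hs) hzq
  obtain ⟨m, hm⟩ : (q : ℤ) ∣ nrd z := hznrd ▸ hs
  have hqp : ((q : ℤ) : HurwitzThree) = star p * p := by rw [star_mul_eq, hpq]
  obtain ⟨y, hy⟩ : ∃ y, p * x = y * p := by
    refine ⟨a * (q : ℤ) * k + b * (trd z : ℤ) * k - b * (m : ℤ) * star p + (s : ℤ), ?_⟩
    have hx : x = z + (s : HurwitzThree) := by rw [hz]; abel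
    have h1 : p * z = (a * (q : ℤ) * k + b * (trd z : ℤ) * k - b * (m : ℤ) * star p) * p := by
      have hcast : (nrd z : HurwitzThree) = (m : HurwitzThree) * ((q : ℤ) : HurwitzThree) := by
        rw [hm, mul_comm]; push_cast; rfl
      calc p * z = a * (q : ℤ) * z + b * (z * z) := by nth_rw 1 [hp]; noncomm_ring
        _ = a * (q : ℤ) * z + b * ((trd z : ℤ) * z - (m : ℤ) * (star p * p)) := by
          rw [sq_eq, hcast, hqp]
        _ = a * (q : ℤ) * (k * p) + b * ((trd z : ℤ) * (k * p) - (m : ℤ) * (star p * p)) := by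
          rw [← hzk]
        _ = _ := by noncomm_ring
    rw [hx, mul_add, h1, add_mul, Int.cast_comm s p]
  have hq0 : (q : ℤ) ≠ 0 := by exact_mod_cast hq.ne_zero
  have hynrd : nrd y = nrd x := by
    have := congrArg nrd hy
    rw [nrd_mul, nrd_mul, hpq] at this
    exact (mul_left_cancel₀ hq0 (by rw [this, mul_comm])).symm
  have hytrd : trd y = 1 := by
    have h1 : y * ((q : ℤ) : HurwitzThree) = p * x * star p := by
      rw [hy, mul_assoc, mul_star_eq, hpq]
    have h2 : trd (y * ((q : ℤ) : HurwitzThree)) = trd y * q := by simp [trd]; ring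
    have h3 : trd (p * x * star p) = nrd p * trd x := by
      simp [trd, nrd]; ring
    rw [h1, h3, hpq, htr] at h2
    exact mul_left_cancel₀ hq0 (by linarith)
  refine ⟨y, hytrd, hynrd, ?_⟩
  have hv : 3 ∣ y.imJ + y.imK := by
    rw [← hynrd] at hN
    unfold trd at hytrd
    have h1 : y.imI = 2 * y.re - 1 := by linarith
    have h2 : (y.imJ + y.imK) ^ 2 = nrd y - 1 + 3 * (y.imJ * y.imK) - 3 * (y.re ^ 2 - y.re) := by
      unfold nrd; rw [h1]; ring
    have h3 : (3 : ℤ) ∣ (y.imJ + y.imK) ^ 2 := by rw [h2]; omega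
    exact Int.prime_three.dvd_of_dvd_pow h3
  have c0 := congrArg QuaternionAlgebra.re hy
  have c1 := congrArg QuaternionAlgebra.imI hy
  have c2 := congrArg QuaternionAlgebra.imJ hy
  have c3 := congrArg QuaternionAlgebra.imK hy
  simp only [QuaternionAlgebra.re_mul, QuaternionAlgebra.imI_mul, QuaternionAlgebra.imJ_mul,
    QuaternionAlgebra.imK_mul] at c0 c1 c2 c3
  unfold nrd at hpq
  unfold trd at htr hytrd
  have three : (3 : ZMod 3) = 0 := by decide
  have hx0 : (x.re : ZMod 3) = 2 + 2 * x.imI := by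
    have := congrArg (Int.cast (R := ZMod 3)) htr
    push_cast at this
    linear_combination 2 * this - x.re * three
  have hy0 : (y.re : ZMod 3) = 2 + 2 * y.imI := by
    have := congrArg (Int.cast (R := ZMod 3)) hytrd
    push_cast at this
    linear_combination 2 * this - y.re * three
  have hxJ := (ZMod.intCast_zmod_eq_zero_iff_dvd x.imJ 3).2 hJ
  have hxK := (ZMod.intCast_zmod_eq_zero_iff_dvd x.imK 3).2 hK
  have hyK : (y.imK : ZMod 3) = -y.imJ := by
    have := (ZMod.intCast_zmod_eq_zero_iff_dvd (y.imJ + y.imK) 3).2 hv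
    push_cast at this
    linear_combination this
  have hq' : ((q : ℤ) : ZMod 3) = 2 := by
    rw [Int.cast_natCast, ← ZMod.natCast_mod, hq3]; rfl
  replace hpq := congrArg (Int.cast (R := ZMod 3)) hpq
  replace c0 := congrArg (Int.cast (R := ZMod 3)) c0
  replace c1 := congrArg (Int.cast (R := ZMod 3)) c1
  replace c2 := congrArg (Int.cast (R := ZMod 3)) c2
  replace c3 := congrArg (Int.cast (R := ZMod 3)) c3
  rw [hq'] at hpq
  push_cast at hpq c0 c1 c2 c3
  rw [hx0, hy0, hxJ, hxK, hyK] at c0 c1 c2 c3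
  refine (ZMod.intCast_zmod_eq_zero_iff_dvd y.imI 3).1
    (imI_eq_zero_of_conj_mod_three x.imI y.imI y.imJ p.re p.imI p.imJ p.imK
      (fun h => hI ((ZMod.intCast_zmod_eq_zero_iff_dvd x.imI 3).1 h)) hpq ?_ ?_ ?_ ?_)
  · linear_combination c0
  · linear_combination c2
  · linear_combination c1
  · linear_combination c3

/-- The form `N(α) + N(β)`, with `N` the norm form of the Eisenstein integers, represents every
prime. -/
theorem exists_nrd_eq_prime {p : ℕ} (hp : p.Prime) :
    ∃ x : HurwitzThree, nrd x = p := by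
  have := Fact.mk hp
  obtain ⟨a, b, hab⟩ := ZMod.sq_add_sq p (-3)
  obtain ⟨c, rfl⟩ := ZMod.intCast_surjective a
  obtain ⟨d, rfl⟩ := ZMod.intCast_surjective b
  have hd : (p : ℤ) ∣ nrd ⟨c + 1, 2, d, 0⟩ := by
    rw [← ZMod.intCast_zmod_eq_zero_iff_dvd]
    simp only [nrd]
    push_cast
    linear_combination hab
  by_cases h2 : p = 2
  · exact ⟨⟨1, 0, 1, 0⟩, by rw [h2]; simp [nrd]⟩
  obtain ⟨x, -, -, -, hx, -⟩ := exists_generator hp hd fun y hy => by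
    have h4 := congrArg QuaternionAlgebra.imI hy
    simp at h4
    have h5 : (p : ℤ) ∣ 2 := ⟨y.imI, by linarith⟩
    exact h2 ((Nat.prime_dvd_prime_iff_eq hp Nat.prime_two).1 (by exact_mod_cast h5))
  exact ⟨x, hx⟩

end HurwitzThree

open MeasureTheory Module in
/-- Minkowski's theorem for three-dimensional ellipsoids. -/
theorem exists_int_ne_zero_sum_sq_lt (A : Matrix (Fin 3) (Fin 3) ℝ) (hA : A.det ≠ 0) {r : ℝ}
    (hr : 0 < r) (h : |A.det| * 8 < r ^ 3 * (Real.pi * 4 / 3)) :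
    ∃ v : Fin 3 → ℤ, v ≠ 0 ∧ ∑ i, (A.mulVec (fun j => (v j : ℝ)) i) ^ 2 < r ^ 2 := by
  have hdet : LinearMap.det (Matrix.toLin' A) ≠ 0 := by rwa [LinearMap.det_toLin']
  let b : Basis (Fin 3) ℝ (Fin 3 → ℝ) :=
    (Pi.basisFun ℝ (Fin 3)).map ((Matrix.toLin' A).equivOfDetNeZero hdet)
  have hb (i j : Fin 3) : b i j = A j i := by
    have : b i = Matrix.toLin' A (Pi.basisFun ℝ (Fin 3) i) := by
      simp only [b, Basis.map_apply]; rfl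
    rw [this]; simp [Matrix.toLin'_apply]
  let s : Set (Fin 3 → ℝ) := (WithLp.toLp 2) ⁻¹' (Metric.ball (0 : EuclideanSpace ℝ (Fin 3)) r)
  have hs : volume s = ENNReal.ofReal (r ^ 3 * (Real.pi * 4 / 3)) := by
    rw [(PiLp.volume_preserving_toLp (Fin 3)).measure_preimage
      Metric.isOpen_ball.measurableSet.nullMeasurableSet, EuclideanSpace.volume_ball_fin_three,
      ENNReal.ofReal_mul (by positivity), ENNReal.ofReal_pow hr.le]
  have hF : volume (ZSpan.fundamentalDomain b) = ENNReal.ofReal |A.det| := by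
    rw [ZSpan.volume_fundamentalDomain, ← Matrix.det_transpose A]
    congr 3
    ext i j
    exact hb i j
  have hconv : Convex ℝ s :=
    (convex_ball (0 : EuclideanSpace ℝ (Fin 3)) r).linear_preimage
      (WithLp.linearEquiv 2 ℝ (Fin 3 → ℝ)).symm.toLinearMap
  have : Countable (Submodule.span ℤ (Set.range b)).toAddSubgroup :=
    inferInstanceAs (Countable (Submodule.span ℤ (Set.range b)))
  obtain ⟨x, hx0, hx⟩ := exists_ne_zero_mem_lattice_of_measure_mul_two_pow_lt_measure
    (ZSpan.isAddFundamentalDomain' b volume) (s := s)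
    (fun x hx => by simpa [s] using hx) hconv (by
      rw [hs, hF, finrank_fin_fun, show (2 : ENNReal) ^ 3 = ENNReal.ofReal 8 by norm_num,
        ← ENNReal.ofReal_mul (abs_nonneg _)]
      exact (ENNReal.ofReal_lt_ofReal_iff (by positivity)).2 h)
  obtain ⟨c, hc⟩ := (Submodule.mem_span_range_iff_exists_fun ℤ).1
    (show (x : Fin 3 → ℝ) ∈ Submodule.span ℤ (Set.range b) from x.2)
  have hcx : A.mulVec (fun j => (c j : ℝ)) = x := by
    rw [← hc]
    ext i
    simp [Matrix.mulVec, dotProduct, Finset.sum_apply, hb, mul_comm]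
  refine ⟨c, ?_, ?_⟩
  · rintro rfl
    apply hx0
    ext i
    rw [← hcx]
    simp [Matrix.mulVec, dotProduct]
  · rw [hcx]
    have h1 : ‖(WithLp.toLp 2 (x : Fin 3 → ℝ) : EuclideanSpace ℝ (Fin 3))‖ < r := by
      simpa [s] using hx
    have h2 := pow_lt_pow_left₀ h1 (norm_nonneg _) two_ne_zero
    rw [EuclideanSpace.norm_sq_eq] at h2
    simpa using h2

theorem exists_ternary_lt {q M : ℕ} (hq : 0 < q) (hM : 0 < M) {b h : ℤ}
    (hb : b ^ 2 + 3 * M = 4 * q * h) :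
    ∃ x y z : ℤ, (x ≠ 0 ∨ y ≠ 0 ∨ z ≠ 0) ∧
      (2 * q * x + b * y + M * z) ^ 2 + 4 * (q * x ^ 2 + b * x * y + h * y ^ 2) < 4 * M := by
  have hq' : (0 : ℝ) < q := by exact_mod_cast hq
  have hM' : (0 : ℝ) < M := by exact_mod_cast hM
  set u := √(q : ℝ) with hu
  set w := √(M : ℝ) with hw
  have hu0 : 0 < u := Real.sqrt_pos.2 hq'
  have hw0 : 0 < w := Real.sqrt_pos.2 hM'
  have hu2 : u ^ 2 = q := Real.sq_sqrt hq'.le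
  have hw2 : w ^ 2 = M := Real.sq_sqrt hM'.le
  have ht2 : √(3 : ℝ) ^ 2 = 3 := Real.sq_sqrt (by norm_num)
  have ht0 : 0 < √(3 : ℝ) := by positivity
  let A : Matrix (Fin 3) (Fin 3) ℝ :=
    !![2 * q, b, M; 2 * u, b / u, 0; 0, √3 * w / u, 0]
  have hdet : A.det = 2 * √3 * w ^ 3 := by
    simp only [A, Matrix.det_fin_three]
    simp
    field_simp
    rw [← hw2]
  have ht : √(3 : ℝ) < 1.8 := by rw [Real.sqrt_lt' (by norm_num)]; norm_num
  obtain ⟨v, hv0, hv⟩ := exists_int_ne_zero_sum_sq_lt A (by rw [hdet]; positivity)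
    (r := 2 * w) (by positivity) (by
      rw [hdet, abs_of_pos (by positivity)]
      have := Real.pi_gt_three
      have h3 : 0 < w ^ 3 := by positivity
      nlinarith)
  refine ⟨v 0, v 1, v 2, ?_, ?_⟩
  · by_contra! hc
    exact hv0 (funext fun i => by fin_cases i <;> simp [hc])
  · have hb' : (b : ℝ) ^ 2 + 3 * M = 4 * q * h := by exact_mod_cast hb
    have e : ∑ i, (A.mulVec (fun j => (v j : ℝ)) i) ^ 2 =
        (2 * q * v 0 + b * v 1 + M * v 2) ^ 2 +
          4 * (q * v 0 ^ 2 + b * v 0 * v 1 + h * v 1 ^ 2) := by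
      simp [A, Matrix.mulVec, dotProduct, Fin.sum_univ_three]
      field_simp
      rw [ht2, hw2, hu2]
      linear_combination (v 1 : ℝ) ^ 2 * hb'
    rw [e, mul_pow, hw2] at hv
    have : (2 * q * v 0 + b * v 1 + M * v 2) ^ 2 +
          4 * (q * v 0 ^ 2 + b * v 0 * v 1 + h * v 1 ^ 2) < (4 * M : ℝ) := by linarith
    exact_mod_cast this

theorem exists_prime_modEq_modEq {m n a b : ℕ} (hmn : m.Coprime n) (hm : m ≠ 0) (hn : n ≠ 0)
    (ha : a.Coprime m) (hb : b.Coprime n) (N : ℕ) :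
    ∃ q > N, q.Prime ∧ q ≡ a [MOD m] ∧ q ≡ b [MOD n] := by
  obtain ⟨c, hca, hcb⟩ := Nat.chineseRemainder hmn a b
  have hc : c.Coprime (m * n) := Nat.Coprime.mul_right
    (by rw [Nat.Coprime, hca.gcd_eq]; exact ha) (by rw [Nat.Coprime, hcb.gcd_eq]; exact hb)
  obtain ⟨q, hqN, hq, hqc⟩ :=
    Nat.forall_exists_prime_gt_and_modEq N (mul_ne_zero hm hn) hc
  exact ⟨q, hqN, hq, (hqc.of_mul_right n).trans hca, (hqc.of_mul_left m).trans hcb⟩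

theorem jacobiSym_neg_three_mul {q M : ℕ} (hq : Odd q) (hM : M % 4 = 1) :
    J(-3 * M | q) = J(q | 3) * J(q | M) := by
  rw [jacobiSym.mul_left, jacobiSym_neg_three hq,
    jacobiSym.quadratic_reciprocity_one_mod_four hM hq]

theorem exists_odd_sq_modEq {q : ℕ} (hq : q.Prime) (hodd : Odd q) {a : ℤ} (ha : J(a | q) = 1) :
    ∃ b : ℤ, Odd b ∧ (q : ℤ) ∣ b ^ 2 - a := by
  have := Fact.mk hq
  obtain ⟨r, hr⟩ := ZMod.isSquare_of_jacobiSym_eq_one ha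
  obtain ⟨b, rfl⟩ := ZMod.intCast_surjective r
  have hb : (q : ℤ) ∣ b ^ 2 - a := by
    rw [← ZMod.intCast_zmod_eq_zero_iff_dvd]
    push_cast
    rw [hr]; ring
  rcases Int.even_or_odd b with he | ho
  · refine ⟨b + q, he.add_odd (by exact_mod_cast hodd), ?_⟩
    rw [show (b + q) ^ 2 - a = (b ^ 2 - a) + q * (2 * b + q) by ring]
    exact dvd_add hb (dvd_mul_right _ _)
  · exact ⟨b, ho, hb⟩

theorem Int.sq_emod_eight_of_odd {a : ℤ} (h : Odd a) : a ^ 2 % 8 = 1 := by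
  have h1 : a % 8 = 1 ∨ a % 8 = 3 ∨ a % 8 = 5 ∨ a % 8 = 7 := by
    have := Int.odd_iff.1 h
    omega
  rcases h1 with h1 | h1 | h1 | h1 <;> simp [pow_two, Int.mul_emod, h1]

theorem even_of_even_form {q b h x y : ℤ} (hq : Odd q) (hb : Odd b) (hh : Odd h)
    (he : Even (q * x ^ 2 + b * x * y + h * y ^ 2)) : Even x ∧ Even y := by
  rw [← Int.not_even_iff_odd] at hq hb hh
  simp only [Int.even_add, Int.even_mul, Int.even_pow] at he
  tauto

theorem odd_of_sq_add_eq {q M : ℕ} {b h : ℤ} (hM8 : M % 8 = 1) (hbo : Odd b)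
    (hb : b ^ 2 + 3 * M = 4 * q * h) : Odd h := by
  have h1 := Int.sq_emod_eight_of_odd hbo
  have h2 : (q * h) % 2 = 1 := by
    have : b ^ 2 + 3 * M = 4 * (q * h) := by rw [hb]; ring
    omega
  exact (Int.odd_mul.1 (Int.odd_iff.2 h2)).2

theorem exists_eq_sq_add_form {q M : ℕ} (hq : Odd q) (hM8 : M % 8 = 1) (hqM : (M : ℤ) ∣ q + 1)
    {b h : ℤ} (hbo : Odd b) (hb : b ^ 2 + 3 * M = 4 * q * h) :
    ∃ R x y : ℤ, M = R ^ 2 + 16 * (q * x ^ 2 + b * x * y + h * y ^ 2) ∧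
      (M : ℤ) ∣ R - 2 * (2 * q * x + b * y) := by
  have hM : 0 < M := by omega
  have hq0 : 0 < q := hq.pos
  have hM' : (0 : ℤ) < M := by exact_mod_cast hM
  have hq' : (0 : ℤ) < q := by exact_mod_cast hq0
  obtain ⟨x, y, z, hne, hlt⟩ := exists_ternary_lt hq0 hM hb
  set B := q * x ^ 2 + b * x * y + h * y ^ 2 with hB
  set R := 2 * q * x + b * y + M * z with hR
  have hB4 : 4 * q * B = (2 * q * x + b * y) ^ 2 + 3 * M * y ^ 2 := by
    rw [hB]; linear_combination -y ^ 2 * hb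
  have hB0 : 0 ≤ B := by
    by_contra! hc
    nlinarith [sq_nonneg (2 * q * x + b * y), sq_nonneg y, mul_pos hM' hq',
      mul_nonneg hM'.le (sq_nonneg y)]
  have hF0 : 0 < R ^ 2 + 4 * B := by
    rcases hB0.lt_or_eq with h0 | h0
    · positivity
    rw [← h0, mul_zero] at hB4 ⊢
    have hy : y = 0 := by
      by_contra hy
      have : 0 < y ^ 2 := by positivity
      nlinarith [sq_nonneg (2 * q * x + b * y), mul_pos hM' this]
    subst hy
    have hx : x = 0 := by
      have : (2 * q * x) ^ 2 = 0 := by linear_combination -hB4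
      have := pow_eq_zero_iff (two_ne_zero) |>.1 this
      simpa [hq0.ne'] using this
    subst hx
    have hz : z ≠ 0 := by simpa using hne
    have : R ≠ 0 := by rw [hR]; simp [hz, hM.ne']
    positivity
  have hdvd : (M : ℤ) ∣ R ^ 2 + 4 * B := by
    have h1 : (M : ℤ) ∣ q * (R ^ 2 + 4 * B) := by
      obtain ⟨k, hk⟩ := hqM
      refine ⟨k * R ^ 2 + 3 * y ^ 2 - 2 * (2 * q * x + b * y) * z - M * z ^ 2, ?_⟩
      linear_combination hB4 + R ^ 2 * hk
    refine IsCoprime.dvd_of_dvd_mul_left ?_ h1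
    obtain ⟨k, hk⟩ := hqM
    exact ⟨k, -1, by linear_combination -hk⟩
  obtain ⟨k, hk⟩ := hdvd
  have hk0 : 0 < k := by by_contra! hc; nlinarith
  have hk4 : k < 4 := by by_contra! hc; nlinarith
  have hsq : R ^ 2 % 4 = 0 ∨ R ^ 2 % 4 = 1 := by
    rcases Int.even_or_odd R with he | ho
    · left; obtain ⟨c, hc⟩ := he; rw [hc]; ring_nf; omega
    · right; have := Int.sq_mod_four_eq_one_of_odd ho; omega
  have hk1 : k = 1 := by
    interval_cases k
    · rfl
    all_goals omega
  rw [hk1, mul_one] at hk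
  have hRo : Odd R := by
    have : Odd (R ^ 2) := by rw [Int.odd_iff]; omega
    exact (Int.odd_pow' two_ne_zero).1 this
  have hR8 := Int.sq_emod_eight_of_odd hRo
  have hBe : Even B := by rw [Int.even_iff]; omega
  obtain ⟨⟨x', hx'⟩, ⟨y', hy'⟩⟩ := even_of_even_form (by exact_mod_cast hq) hbo
    (odd_of_sq_add_eq hM8 hbo hb) hBe
  refine ⟨R, x', y', ?_, z, ?_⟩
  · rw [← hk, hB, hx', hy']; ring
  · rw [hR, hx', hy']; ring

theorem even_padicValInt_form {p q M : ℕ} (hp : p.Prime) (hp3 : p % 3 = 2) (hpq : p ≠ q)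
    (hq : q.Prime) (hqo : Odd q) (hsf : Squarefree M) (hM8 : M % 8 = 1) (hqM : (M : ℤ) ∣ q + 1)
    {b h R x y : ℤ} (hbo : Odd b) (hb : b ^ 2 + 3 * M = 4 * q * h)
    (hM : M = R ^ 2 + 16 * (q * x ^ 2 + b * x * y + h * y ^ 2))
    (hR : (M : ℤ) ∣ R - 2 * (2 * q * x + b * y)) :
    Even (padicValInt p (q * x ^ 2 + b * x * y + h * y ^ 2)) := by
  have := Fact.mk hp
  rcases hp.eq_two_or_odd' with rfl | hpo
  · refine even_padicValInt_of_anisotropic hp (fun x y hd => ?_) x y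
    have := even_of_even_form (by exact_mod_cast hqo) hbo (odd_of_sq_add_eq hM8 hbo hb)
      (even_iff_two_dvd.2 hd)
    exact ⟨even_iff_two_dvd.1 this.1, even_iff_two_dvd.1 this.2⟩
  have hp2 : ¬ (p : ℤ) ∣ 2 := fun hd => by
    have hd : p ∣ 2 := by exact_mod_cast hd
    rw [Nat.prime_dvd_prime_iff_eq hp Nat.prime_two] at hd
    subst hd; exact absurd hpo (by decide)
  have hpZ : Prime (p : ℤ) := Nat.prime_iff_prime_int.1 hp
  have hpqZ : ¬ (p : ℤ) ∣ q := fun hd =>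
    hpq ((Nat.prime_dvd_prime_iff_eq hp hq).1 (Int.natCast_dvd_natCast.1 hd))
  have hJ3 : J(-3 | p) = -1 := by
    rw [jacobiSym_neg_three hpo, jacobiSym_three_of_mod_two hp3]
  by_cases hv : (p : ℤ) ∣ q * x ^ 2 + b * x * y + h * y ^ 2
  swap
  · rw [padicValInt.eq_zero_of_not_dvd hv]; exact Even.zero
  by_cases hpM : (p : ℤ) ∣ M
  · exfalso
    obtain ⟨v, hv⟩ := hv
    have hpR : (p : ℤ) ∣ R := by
      have : (p : ℤ) ∣ R ^ 2 := by
        rw [show R ^ 2 = M - p * (16 * v) by rw [hM, hv]; ring]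
        exact dvd_sub hpM (dvd_mul_right _ _)
      exact hpZ.dvd_of_dvd_pow this
    have hpL : (p : ℤ) ∣ 2 * q * x + b * y := by
      have : (p : ℤ) ∣ 2 * (2 * q * x + b * y) := by
        simpa using dvd_sub hpR (hpM.trans hR)
      exact (hpZ.dvd_or_dvd this).resolve_left hp2
    have hL : (2 * q * x + b * y) ^ 2 + 3 * M * y ^ 2 =
        4 * q * (q * x ^ 2 + b * x * y + h * y ^ 2) := by linear_combination y ^ 2 * hb
    obtain ⟨L, hL'⟩ := hpL
    obtain ⟨S, rfl⟩ := hpR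
    obtain ⟨m, hm⟩ := hpM
    have hp0 := hpZ.ne_zero
    have e1 : m = p * S ^ 2 + 16 * v := by
      apply mul_left_cancel₀ hp0
      rw [← hm, hM, hv]; ring
    have e2 : p * L ^ 2 + 3 * m * y ^ 2 = 4 * q * v := by
      apply mul_left_cancel₀ hp0
      rw [hL', hv, hm] at hL
      linear_combination hL
    have hpm : ¬ (p : ℤ) ∣ m := by
      rintro ⟨m', rfl⟩
      have h1 : p * p ∣ M := by
        rw [← Int.natCast_dvd_natCast]
        exact ⟨m', by rw [hm]; push_cast; ring⟩
      exact hp.one_lt.ne' (Nat.isUnit_iff.1 (hsf p h1))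
    have h1 : (p : ℤ) ∣ m * (q - 12 * y ^ 2) :=
      ⟨q * S ^ 2 + 4 * L ^ 2, by linear_combination q * e1 - 4 * e2⟩
    have h2 := (hpZ.dvd_or_dvd h1).resolve_left hpm
    have h3 : (p : ℤ) ∣ q + 1 := (Dvd.intro m hm.symm).trans hqM
    have h4 : (p : ℤ) ∣ (6 * y) ^ 2 - -3 * 1 ^ 2 := by
      rw [show (6 * y) ^ 2 - -3 * 1 ^ 2 = 3 * ((q + 1) - (q - 12 * y ^ 2)) by ring]
      exact (dvd_sub h3 h2).mul_left 3
    exact hpZ.not_isUnit (isUnit_of_dvd_one (jacobiSym.prime_dvd_of_eq_neg_one hJ3 h4).2)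
  · have hJM : J(M | p) = 1 := by
      have hpR : ¬ (p : ℤ) ∣ R := fun hd => hpM (by
        rw [hM]; exact dvd_add (hd.pow two_ne_zero) (hv.mul_left 16))
      have e : J(M | p) = J(R ^ 2 | p) := by
        apply jacobiSym.mod_left'
        apply Int.emod_emod_of_dvd _ (dvd_refl _) |>.symm.trans
        rw [Int.emod_emod_of_dvd _ (dvd_refl _)]
        refine Int.ModEq.symm ((Int.modEq_iff_dvd).2 ?_)
        rw [hM]; simpa using hv.mul_left 16
      rw [e]
      exact jacobiSym.sq_one' (Int.isCoprime_iff_gcd_eq_one.1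
        ((hpZ.coprime_iff_not_dvd.2 hpR).symm))
    have hJ : J(-3 * M | p) = -1 := by rw [jacobiSym.mul_left, hJ3, hJM, mul_one]
    refine even_padicValInt_of_anisotropic hp (fun x y hd => ?_) x y
    have h1 : (p : ℤ) ∣ (2 * q * x + b * y) ^ 2 - -3 * M * y ^ 2 := by
      rw [show (2 * q * x + b * y) ^ 2 - -3 * M * y ^ 2 =
        4 * q * (q * x ^ 2 + b * x * y + h * y ^ 2) by linear_combination y ^ 2 * hb]
      exact hd.mul_left _
    obtain ⟨h2, h3⟩ := jacobiSym.prime_dvd_of_eq_neg_one hJ h1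
    refine ⟨?_, h3⟩
    have h4 : (p : ℤ) ∣ 2 * q * x := (dvd_add_left (h3.mul_left b)).1 h2
    exact (hpZ.dvd_or_dvd h4).resolve_left fun h => (hpZ.dvd_or_dvd h).elim hp2 hpqZ

theorem exists_eq_sq_add_sixteen_mul {M : ℕ} (hsf : Squarefree M) (hM : M % 24 = 1) :
    ∃ R v : ℤ, M = R ^ 2 + 16 * v ∧ IsEisensteinNorm v := by
  have hM0 : M ≠ 0 := by omega
  have hM3 : M.Coprime 3 :=
    ((Nat.prime_three.coprime_iff_not_dvd).2 (by omega)).symm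
  have hc : (M - 1).Coprime M := by
    have := Nat.coprime_self_sub_left (m := 1) (n := M) (by omega)
    exact this.2 (Nat.coprime_one_left M)
  obtain ⟨q, hq2, hq, hqM, hq3⟩ :=
    exists_prime_modEq_modEq hM3 hM0 three_ne_zero hc (Nat.coprime_one_left 3) 2
  have hqo : Odd q := hq.odd_of_ne_two (by omega)
  have hqM' : (M : ℤ) ∣ q + 1 := by
    have := (Nat.modEq_iff_dvd.1 hqM.symm)
    rw [Nat.cast_sub (by omega)] at this
    have := dvd_add this (dvd_refl (M : ℤ))
    rwa [Nat.cast_one, sub_sub_eq_add_sub, sub_add_cancel] at this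
  have hq3' : q % 3 = 1 := hq3
  have hJ : J(-3 * M | q) = 1 := by
    rw [jacobiSym_neg_three_mul hqo (by omega), jacobiSym_three_of_mod_one hq3', one_mul,
      show J((q : ℤ) | M) = J(-1 | M) from jacobiSym.mod_left' ((Int.modEq_iff_dvd.2 (by
        rw [← dvd_neg, neg_sub, sub_neg_eq_add]; exact hqM'))),
      jacobiSym.at_neg_one (by rw [Nat.odd_iff]; omega), ZMod.χ₄_nat_one_mod_four (by omega)]
  obtain ⟨b, hbo, hb⟩ := exists_odd_sq_modEq hq hqo hJ
  obtain ⟨h, hh⟩ : (4 * q : ℤ) ∣ b ^ 2 + 3 * M := by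
    refine IsCoprime.mul_dvd ?_ ?_ (by rwa [neg_mul, sub_neg_eq_add] at hb)
    · have : Nat.Coprime (2 ^ 2) q := Nat.Coprime.pow_left 2 (Nat.coprime_two_left.2 hqo)
      exact_mod_cast (Nat.isCoprime_iff_coprime.2 this)
    · have := Int.sq_emod_eight_of_odd hbo
      omega
  obtain ⟨R, x, y, hR, hRd⟩ := exists_eq_sq_add_form hqo (by omega) hqM' hbo hh
  refine ⟨R, _, hR, ?_⟩
  have hv0 : 0 ≤ q * x ^ 2 + b * x * y + h * y ^ 2 := by
    have hq' : (0 : ℤ) < q := by exact_mod_cast hq.pos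
    have hL : (2 * q * x + b * y) ^ 2 + 3 * M * y ^ 2 =
        4 * q * (q * x ^ 2 + b * x * y + h * y ^ 2) := by linear_combination y ^ 2 * hh
    have : 0 ≤ 4 * q * (q * x ^ 2 + b * x * y + h * y ^ 2) := by rw [← hL]; positivity
    by_contra! hc
    nlinarith
  have hev (p : ℕ) (hp : p.Prime) (hp3 : p % 3 = 2) :=
    even_padicValInt_form hp hp3 (by rintro rfl; omega) hq hqo hsf (by omega) hqM' hbo hh hR hRd
  generalize q * x ^ 2 + b * x * y + h * y ^ 2 = v at hv0 hev
  lift v to ℕ using hv0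
  exact isEisensteinNorm_of_even_padicValNat v fun p hp hp3 => by simpa using hev p hp hp3

theorem exists_coprime_jacobiSym_eq_neg_one {M : ℕ} (hsf : Squarefree M) (hodd : Odd M)
    (h1 : M ≠ 1) : ∃ u : ℕ, u.Coprime M ∧ J(u | M) = -1 := by
  obtain ⟨p, hp, m, rfl⟩ := Nat.exists_prime_and_dvd h1
  have := Fact.mk hp
  have hp2 : p ≠ 2 := by rintro rfl; exact absurd (Nat.odd_mul.1 hodd).1 (by decide)
  have hpm : p.Coprime m := Nat.coprime_of_squarefree_mul hsf
  obtain ⟨r, hr⟩ := FiniteField.exists_nonsquare (F := ZMod p) (by rwa [ZMod.ringChar_zmod_n])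
  have hJ : J((r.val : ℤ) | p) = -1 := by
    rw [ZMod.nonsquare_iff_jacobiSym_eq_neg_one]
    simpa using hr
  have hrp : r.val.Coprime p := by
    by_contra hc
    have : J((r.val : ℤ) | p) = 0 := jacobiSym.eq_zero_iff_not_coprime.2 hc
    omega
  obtain ⟨u, hur, hu1⟩ := Nat.chineseRemainder hpm r.val 1
  refine ⟨u, Nat.Coprime.mul_right (by rw [Nat.Coprime, hur.gcd_eq]; exact hrp)
    (by rw [Nat.Coprime, hu1.gcd_eq]; exact Nat.coprime_one_left m), ?_⟩
  have hm0 : m ≠ 0 := by rintro rfl; simp at hsf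
  rw [jacobiSym.mul_right' _ hp.ne_zero hm0,
    jacobiSym.mod_left' (a₂ := (r.val : ℤ)) (by exact_mod_cast hur), hJ,
    jacobiSym.mod_left' (a₂ := 1) (by exact_mod_cast hu1), jacobiSym.one_left, mul_one]

namespace HurwitzThree

theorem four_mul_nrd_sub_trd_sq (x : HurwitzThree) :
    4 * nrd x - trd x ^ 2 =
      3 * x.imI ^ 2 + 4 * (x.imJ ^ 2 - x.imJ * x.imK + x.imK ^ 2) := by
  simp only [nrd, trd]; ring

theorem exists_sq_add_of_three_dvd_imI {M : ℕ} (hM : M % 24 = 1) {y : HurwitzThree}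
    (htr : trd y = 1) (hN : 4 * nrd y - 1 = 3 * M) (hI : 3 ∣ y.imI) :
    ∃ X v : ℤ, M = 9 * X ^ 2 + 16 * v ∧ IsEisensteinNorm v := by
  have h := four_mul_nrd_sub_trd_sq y
  rw [htr, one_pow, hN] at h
  have hodd : Odd y.imI := ⟨y.re - 1, by simp only [trd] at htr; linarith⟩
  have h8 := Int.sq_emod_eight_of_odd hodd
  have heven : Even (1 * y.imJ ^ 2 + (-1) * y.imJ * y.imK + 1 * y.imK ^ 2) := by
    rw [show 1 * y.imJ ^ 2 + (-1) * y.imJ * y.imK + 1 * y.imK ^ 2 =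
      y.imJ ^ 2 - y.imJ * y.imK + y.imK ^ 2 by ring, Int.even_iff]
    omega
  obtain ⟨⟨a, ha⟩, ⟨b, hb⟩⟩ := even_of_even_form odd_one (by decide) odd_one heven
  obtain ⟨X, hX⟩ := hI
  rw [hX, ha, hb] at h
  obtain ⟨t, ht⟩ : (3 : ℤ) ∣ a + b := by
    have : (3 : ℤ) ∣ (a + b) ^ 2 :=
      ⟨M - 9 * X ^ 2 - 5 * (a ^ 2 - a * b + b ^ 2) + a * b, by linear_combination -h⟩
    exact Int.prime_three.dvd_of_dvd_pow this
  obtain rfl : b = 3 * t - a := by linarith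
  exact ⟨X, _, by linarith, a - t, t, rfl⟩

end HurwitzThree

open HurwitzThree in
theorem exists_eq_nine_mul_sq_add_of_squarefree {M : ℕ} (hsf : Squarefree M) (hM : M % 24 = 1)
    (h1 : M ≠ 1) : ∃ X v : ℤ, M = 9 * X ^ 2 + 16 * v ∧ IsEisensteinNorm v := by
  obtain ⟨R, _, hR, a, b, rfl⟩ := exists_eq_sq_add_sixteen_mul hsf hM
  by_cases hR3 : (3 : ℤ) ∣ R
  · obtain ⟨X, rfl⟩ := hR3
    exact ⟨X, _, by rw [hR]; ring, a, b, rfl⟩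
  have hRo : Odd R := by
    have : Odd (R ^ 2) := by rw [Int.odd_iff]; omega
    exact (Int.odd_pow' two_ne_zero).1 this
  obtain ⟨r, hr⟩ := hRo
  have hab : (3 : ℤ) ∣ a + b := by
    have hR1 : R ^ 2 % 3 = 1 := by
      have : R % 3 = 1 ∨ R % 3 = 2 := by omega
      rcases this with h | h <;> simp [pow_two, Int.mul_emod, h]
    have h2 : (3 : ℤ) ∣ a ^ 2 - a * b + b ^ 2 := by omega
    have h3 : (3 : ℤ) ∣ (a + b) ^ 2 := by
      rw [show (a + b) ^ 2 = (a ^ 2 - a * b + b ^ 2) + 3 * (a * b) by ring]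
      exact dvd_add h2 (dvd_mul_right _ _)
    exact Int.prime_three.dvd_of_dvd_pow h3
  let x : HurwitzThree := ⟨r + 1, R, 2 * (a - 2 * b), 2 * (2 * a - b)⟩
  have htr : trd x = 1 := by simp only [trd, x]; linarith
  have hN : 4 * nrd x - 1 = 3 * M := by
    have := four_mul_nrd_sub_trd_sq x
    rw [htr] at this
    simp only [x] at this
    rw [one_pow] at this
    rw [this, hR]; ring
  have hodd : Odd M := by rw [Nat.odd_iff]; omega
  obtain ⟨u, huM, hu⟩ := exists_coprime_jacobiSym_eq_neg_one hsf hodd h1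
  have hM3 : M.Coprime 3 := ((Nat.prime_three.coprime_iff_not_dvd).2 (by omega)).symm
  obtain ⟨q, hqM, hq, hqu, hq3⟩ := exists_prime_modEq_modEq hM3 (by omega) three_ne_zero huM
    (show Nat.Coprime 2 3 by decide) (M + 3)
  have hqo : Odd q := hq.odd_of_ne_two (by omega)
  have hJ : J(-3 * M | q) = 1 := by
    rw [jacobiSym_neg_three_mul hqo (by omega), jacobiSym_three_of_mod_two hq3,
      jacobiSym.mod_left' (a₂ := (u : ℤ)) (by exact_mod_cast hqu), hu]
    norm_num
  obtain ⟨t, ⟨s, rfl⟩, ht⟩ := exists_odd_sq_modEq hq hqo hJ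
  have hqZ : Prime (q : ℤ) := Nat.prime_iff_prime_int.1 hq
  have hs : (q : ℤ) ∣ (s + 1) ^ 2 - (s + 1) + nrd x := by
    have h4 : (q : ℤ) ∣ 4 * ((s + 1) ^ 2 - (s + 1) + nrd x) := by
      convert ht using 1; linear_combination hN
    refine (hqZ.dvd_or_dvd h4).resolve_left fun hd => ?_
    have := Int.le_of_dvd (by norm_num) hd
    omega
  have hdisc : ¬ (q : ℤ) ∣ 4 * nrd x - 1 := by
    rw [hN]
    intro hd
    rcases hqZ.dvd_or_dvd hd with hd | hd
    · have := Int.le_of_dvd (by norm_num) hd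
      omega
    · have := Int.le_of_dvd (by omega) hd
      omega
  obtain ⟨y, hy1, hy2, hy3⟩ := exists_three_dvd_imI hq hq3 htr (by omega) hR3
    (show 3 ∣ 2 * (a - 2 * b) by omega) (show 3 ∣ 2 * (2 * a - b) by omega) hs hdisc
  exact exists_sq_add_of_three_dvd_imI hM hy1 (by rw [hy2, hN]) hy3

theorem exists_eq_nine_mul_sq_add_of_not_isSquare {M : ℕ} (hM : M % 24 = 1) (h : ¬ IsSquare M) :
    ∃ X v : ℤ, M = 9 * X ^ 2 + 16 * v ∧ IsEisensteinNorm v := by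
  obtain ⟨m, k, rfl, hm⟩ := Nat.sq_mul_squarefree M
  have hk : k ^ 2 % 24 = 1 := by
    have h2 : k % 2 = 1 := by
      by_contra hc
      obtain ⟨c, rfl⟩ : 2 ∣ k := by omega
      have : (2 * c) ^ 2 * m = 2 * (2 * c ^ 2 * m) := by ring
      omega
    have h3 : k % 3 ≠ 0 := by
      intro hc
      obtain ⟨c, rfl⟩ : 3 ∣ k := by omega
      have : (3 * c) ^ 2 * m = 3 * (3 * c ^ 2 * m) := by ring
      omega
    have : k % 24 < 24 := Nat.mod_lt _ (by norm_num)
    have h24 : k % 24 % 2 = 1 ∧ k % 24 % 3 ≠ 0 := by omega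
    rw [Nat.pow_mod]
    generalize k % 24 = r at *
    interval_cases r <;> simp_all
  obtain ⟨X, v, hXv, hv⟩ := exists_eq_nine_mul_sq_add_of_squarefree hm
    (by rw [Nat.mul_mod, hk, one_mul, Nat.mod_mod] at hM; exact hM)
    (by rintro rfl; exact h ⟨k, by ring⟩)
  refine ⟨k * X, k ^ 2 * v, by push_cast; rw [hXv]; ring, IsEisensteinNorm.mul ⟨k, 0, by ring⟩ hv⟩

theorem Nat.Prime.exists_eisensteinNorm_add_four_mul {p : ℕ} (hp : p.Prime) (hodd : Odd p) :
    ∃ c d : ℤ, p = c + 4 * d ∧ IsEisensteinNorm c ∧ IsEisensteinNorm d := by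
  obtain ⟨x, hx⟩ := HurwitzThree.exists_nrd_eq_prime hp
  have key (a b c d : ℤ) (h : (a ^ 2 - a * b + b ^ 2) + (c ^ 2 - c * d + d ^ 2) = p)
      (he : Even (1 * c ^ 2 + (-1) * c * d + 1 * d ^ 2)) :
      ∃ c d : ℤ, p = c + 4 * d ∧ IsEisensteinNorm c ∧ IsEisensteinNorm d := by
    obtain ⟨⟨c, rfl⟩, ⟨d, rfl⟩⟩ := even_of_even_form odd_one (by decide) odd_one he
    exact ⟨_, _, by rw [← h]; ring, ⟨a, b, rfl⟩, c, d, rfl⟩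
  simp only [HurwitzThree.nrd] at hx
  by_cases he : Even (1 * x.imJ ^ 2 + (-1) * x.imJ * x.imK + 1 * x.imK ^ 2)
  · exact key _ _ _ _ hx he
  · refine key _ _ _ _ ((add_comm _ _).trans hx) ?_
    have : Odd (p : ℤ) := by exact_mod_cast hodd
    rw [← hx, show x.imJ ^ 2 - x.imJ * x.imK + x.imK ^ 2 =
      1 * x.imJ ^ 2 + (-1) * x.imJ * x.imK + 1 * x.imK ^ 2 by ring] at this
    rw [show 1 * x.re ^ 2 + -1 * x.re * x.imI + 1 * x.imI ^ 2 =
      x.re ^ 2 - x.re * x.imI + x.imI ^ 2 by ring]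
    exact Int.not_odd_iff_even.1 fun ho => he ((Int.odd_add.1 this).1 ho)

theorem IsEisensteinNorm.emod_three {v : ℤ} (h : IsEisensteinNorm v) : v % 3 ≠ 2 := by
  obtain ⟨a, b, rfl⟩ := h
  have ha : a % 3 = 0 ∨ a % 3 = 1 ∨ a % 3 = 2 := by omega
  have hb : b % 3 = 0 ∨ b % 3 = 1 ∨ b % 3 = 2 := by omega
  rcases ha with ha | ha | ha <;> rcases hb with hb | hb | hb <;>
    simp [pow_two, Int.sub_emod, Int.add_emod, Int.mul_emod, ha, hb]

theorem exists_prime_sq_eq_nine_mul_sq_add {p : ℕ} (hp : p.Prime) (hodd : Odd p)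
    (hp3 : p % 3 = 2) : ∃ X v : ℤ, p ^ 2 = 9 * X ^ 2 + 16 * v ∧ IsEisensteinNorm v := by
  obtain ⟨c, d, h, hc, hd⟩ := hp.exists_eisensteinNorm_add_four_mul hodd
  have hc3 := hc.emod_three
  have hd3 := hd.emod_three
  obtain ⟨X, hX⟩ : (3 : ℤ) ∣ 4 * d - c := by
    have : c % 3 = 0 ∨ c % 3 = 1 := by omega
    have : d % 3 = 0 ∨ d % 3 = 1 := by omega
    omega
  refine ⟨X, c * d, ?_, hc.mul hd⟩
  rw [h, show 9 * X ^ 2 = (3 * X) ^ 2 by ring, ← hX]; ring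

theorem IsEisensteinNorm.exists_four_mul_eq {v : ℤ} (h : IsEisensteinNorm v)
    (h3 : ¬ (3 : ℤ) ∣ v) : ∃ y z : ℤ, 4 * v = y ^ 2 + 3 * z ^ 2 ∧ ¬ (3 : ℤ) ∣ z := by
  obtain ⟨a, b, rfl⟩ := h
  by_cases hb : (3 : ℤ) ∣ b
  · refine ⟨2 * b - a, a, by ring, fun ha => h3 ?_⟩
    rw [show a ^ 2 - a * b + b ^ 2 = a * (a - b) + b * b by ring]
    exact dvd_add (ha.mul_right _) (hb.mul_right _)
  · exact ⟨2 * a - b, b, by ring, hb⟩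

theorem exists_eq_or_eq_neg_emod_three_eq_one {a : ℤ} (h : ¬ (3 : ℤ) ∣ a) :
    ∃ b, (b = a ∨ b = -a) ∧ b % 3 = 1 := by
  rcases (by omega : a % 3 = 1 ∨ a % 3 = 2) with h | h
  · exact ⟨a, .inl rfl, h⟩
  · exact ⟨-a, .inr rfl, by omega⟩

theorem exists_solution_of_eq_nine_mul_sq_add {M : ℕ} (hM : M % 24 = 1) {X v : ℤ}
    (h : M = 9 * X ^ 2 + 16 * v) (hv : IsEisensteinNorm v) :
    ∃ x y z : ℤ, x ^ 2 + 4 * y ^ 2 + 12 * z ^ 2 = M ∧ x ≡ 3 [ZMOD 12] ∧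
      y - z ≡ 0 [ZMOD 6] ∧ y + z ≡ 2 [ZMOD 6] := by
  obtain ⟨y, z, hyz, hz⟩ := hv.exists_four_mul_eq (by omega)
  have hy : ¬ (3 : ℤ) ∣ y := by
    rintro ⟨w, rfl⟩
    have : (3 * w) ^ 2 = 3 * (3 * w ^ 2) := by ring
    omega
  have hXo : Odd X := by
    have : Odd (X ^ 2) := by rw [Int.odd_iff]; omega
    exact (Int.odd_pow' two_ne_zero).1 this
  obtain ⟨y', hy', hy3⟩ := exists_eq_or_eq_neg_emod_three_eq_one hy
  obtain ⟨z', hz', hz3⟩ := exists_eq_or_eq_neg_emod_three_eq_one hz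
  have hy2 : y' ^ 2 = y ^ 2 := sq_eq_sq_iff_eq_or_eq_neg.2 hy'
  have hz2 : z' ^ 2 = z ^ 2 := sq_eq_sq_iff_eq_or_eq_neg.2 hz'
  have hpar : (y' - z') % 2 = 0 := by
    have : Even (y' ^ 2 + 3 * z' ^ 2) := by
      rw [hy2, hz2, ← hyz, Int.even_iff]; omega
    rw [← Int.even_iff]
    simp only [Int.even_add, Int.even_sub, Int.even_mul, Int.even_pow] at this ⊢
    have h3 : ¬ Even (3 : ℤ) := by decide
    tauto
  obtain ⟨x, hx, hx3⟩ : ∃ x : ℤ, x ^ 2 = 9 * X ^ 2 ∧ x % 12 = 3 := by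
    have := Int.odd_iff.1 hXo
    rcases (by omega : X % 4 = 1 ∨ X % 4 = 3) with h | h
    · exact ⟨3 * X, by ring, by omega⟩
    · exact ⟨-3 * X, by ring, by omega⟩
  refine ⟨x, y', z', by rw [hx, hy2, hz2, h]; linarith, hx3, ?_, ?_⟩
  · show _ % 6 = _ % 6; omega
  · show _ % 6 = _ % 6; omega

theorem exists_sq_eq_nine_mul_sq_add_of_prime_dvd {W p : ℕ} (hW : W ^ 2 % 24 = 1) (hp : p.Prime)
    (hpW : p ∣ W) (hp3 : p % 3 ≠ 1) :
    ∃ X v : ℤ, (W ^ 2 : ℕ) = 9 * X ^ 2 + 16 * v ∧ IsEisensteinNorm v := by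
  obtain ⟨k, rfl⟩ := hpW
  have h3 : p % 3 ≠ 0 := by
    intro hc
    obtain ⟨c, rfl⟩ := Nat.dvd_of_mod_eq_zero hc
    have : (3 * c * k) ^ 2 = 3 * (3 * c ^ 2 * k ^ 2) := by ring
    omega
  have hodd : Odd p := by
    rw [← Nat.not_even_iff_odd]
    rintro ⟨c, rfl⟩
    have : ((c + c) * k) ^ 2 = 2 * (2 * c ^ 2 * k ^ 2) := by ring
    omega
  obtain ⟨X, v, h, hv⟩ := exists_prime_sq_eq_nine_mul_sq_add hp hodd (by omega)
  exact ⟨k * X, k ^ 2 * v, by push_cast; rw [mul_pow, h]; ring,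
    IsEisensteinNorm.mul ⟨k, 0, by ring⟩ hv⟩

theorem not_sq_add_eq_sq {W : ℕ} (hW : W % 3 ≠ 0)
    (hprime : ∀ p : ℕ, p.Prime → p ∣ W → p % 3 = 1) {x y z : ℤ} (hx : (3 : ℤ) ∣ x)
    (hz : ¬ (3 : ℤ) ∣ z) (h : x ^ 2 + 4 * y ^ 2 + 12 * z ^ 2 = (W : ℤ) ^ 2) : False := by
  have hW3 : W % 3 = 1 := by
    by_contra hc
    have hv : ¬ IsEisensteinNorm W := fun h => h.emod_three (by omega)
    apply hv
    refine isEisensteinNorm_of_even_padicValNat W fun p hp hp3 => ?_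
    rw [padicValNat.eq_zero_of_not_dvd fun hd => by have := hprime p hp hd; omega]
    exact Even.zero
  have hpar : (W - x) % 2 = 0 := by
    have : Even ((W : ℤ) ^ 2 - x ^ 2) := by
      rw [← h, Int.even_iff]; omega
    rw [← Int.even_iff]
    simp only [Int.even_sub, Int.even_pow] at this ⊢
    tauto
  obtain ⟨A, hA⟩ : ∃ A, W - x = 2 * A := ⟨(W - x) / 2, by omega⟩
  have hAB : A * (W - A) = y ^ 2 + 3 * z ^ 2 := by
    obtain rfl : x = W - 2 * A := by linarith
    linarith
  have hz0 : z ≠ 0 := by rintro rfl; simp at hz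
  have hpos : 0 < y ^ 2 + 3 * z ^ 2 := by positivity
  have hA0 : 0 < A := by
    by_contra! hc
    nlinarith [mul_nonneg (neg_nonneg.2 hc) (Int.natCast_nonneg W), sq_nonneg A]
  have hB0 : 0 < W - A := by
    by_contra! hc
    nlinarith
  lift A to ℕ using hA0.le
  have hAne : ¬ IsEisensteinNorm A := fun h => h.emod_three (by omega)
  apply hAne
  refine isEisensteinNorm_of_even_padicValNat A fun p hp hp3 => ?_
  have := Fact.mk hp
  by_cases hpA : p ∣ A
  · have hpB : ¬ (p : ℤ) ∣ W - A := fun hd => by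
      have : (p : ℤ) ∣ W := by
        simpa using dvd_add hd (Int.natCast_dvd_natCast.2 hpA)
      have := hprime p hp (Int.natCast_dvd_natCast.1 this)
      omega
    have hN : IsEisensteinNorm (A * (W - A)) := ⟨y + z, 2 * z, by rw [hAB]; ring⟩
    have := hN.even_padicValInt hp hp3
    rw [padicValInt.mul hA0.ne' hB0.ne', padicValInt.eq_zero_of_not_dvd hpB, add_zero] at this
    simpa using this
  · rw [padicValNat.eq_zero_of_not_dvd hpA]
    exact Even.zero

theorem finite_solutions (M : ℤ) :
    {v : ℤ × ℤ × ℤ | v.1 ^ 2 + 4 * v.2.1 ^ 2 + 12 * v.2.2 ^ 2 = M}.Finite := by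
  refine (Set.finite_Icc ((-M, -M, -M) : ℤ × ℤ × ℤ) (M, M, M)).subset ?_
  rintro ⟨x, y, z⟩ h
  simp only [Set.mem_ofPred_eq] at h
  have bound (a : ℤ) (ha : a ^ 2 ≤ M) : -M ≤ a ∧ a ≤ M := by
    have h1 := Int.le_self_sq a
    have h2 := Int.le_self_sq (-a)
    rw [neg_sq] at h2
    constructor <;> linarith
  have hx := bound x (by nlinarith)
  have hy := bound y (by nlinarith)
  have hz := bound z (by nlinarith)
  exact ⟨⟨hx.1, hy.1, hz.1⟩, hx.2, hy.2, hz.2⟩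

theorem stmt_13 (n : ℕ) (hn : 0 < n) :
    Nat.card {v : ℤ × ℤ × ℤ //
        v.1 ^ 2 + 4 * v.2.1 ^ 2 + 12 * v.2.2 ^ 2 = 24 * (n : ℤ) + 1 ∧
        v.1 ≡ 3 [ZMOD 12] ∧ v.2.1 - v.2.2 ≡ 0 [ZMOD 6] ∧ v.2.1 + v.2.2 ≡ 2 [ZMOD 6]} = 0 ↔
      ∃ W : ℕ, 0 < W ∧ 24 * n + 1 = W ^ 2 ∧ ∀ p : ℕ, p.Prime → p ∣ W → p % 3 = 1 := by
  have hfin : Finite {v : ℤ × ℤ × ℤ //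
        v.1 ^ 2 + 4 * v.2.1 ^ 2 + 12 * v.2.2 ^ 2 = 24 * (n : ℤ) + 1 ∧
        v.1 ≡ 3 [ZMOD 12] ∧ v.2.1 - v.2.2 ≡ 0 [ZMOD 6] ∧ v.2.1 + v.2.2 ≡ 2 [ZMOD 6]} :=
    ((finite_solutions (24 * n + 1)).subset fun _ h => h.1).to_subtype
  have hM : (24 * n + 1) % 24 = 1 := by omega
  rw [Finite.card_eq_zero_iff]
  constructor
  · intro hempty
    have hno : ¬ ∃ X v : ℤ, (24 * n + 1 : ℕ) = 9 * X ^ 2 + 16 * v ∧ IsEisensteinNorm v := by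
      rintro ⟨X, v, h, hv⟩
      obtain ⟨x, y, z, h1, h2⟩ := exists_solution_of_eq_nine_mul_sq_add hM h hv
      exact hempty.false ⟨(x, y, z), by rw [h1]; push_cast; rfl, h2⟩
    obtain ⟨W, hW⟩ : IsSquare (24 * n + 1) := by
      by_contra hc
      exact hno (exists_eq_nine_mul_sq_add_of_not_isSquare hM hc)
    rw [← pow_two] at hW
    refine ⟨W, by by_contra! hc; simp_all, hW, fun p hp hpW => ?_⟩
    by_contra hp3
    rw [hW] at hno hM
    exact hno (exists_sq_eq_nine_mul_sq_add_of_prime_dvd hM hp hpW hp3)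
  · rintro ⟨W, -, hW, hprime⟩
    refine ⟨fun ⟨⟨x, y, z⟩, h, hx, hd, hs⟩ => ?_⟩
    simp only [Int.ModEq] at h hx hd hs
    refine not_sq_add_eq_sq (W := W) (fun hc => ?_) hprime (x := x) (y := y) (z := z)
      (by omega) (by omega) (by rw [h]; exact_mod_cast hW)
    obtain ⟨c, rfl⟩ := Nat.dvd_of_mod_eq_zero hc
    rw [mul_pow] at hW
    omega
end

section
/- Let n be a positive integer. Then the number of (x,y,z) ∈ ℤ³ with x²+y²+z² = 8n+1, x ≡ 1 (mod 2), y ≡ 0 (mod 2), and z ≡ 2 (mod 4) is zero if and only if 8n+1 = M² for some positive integer M all of whose prime divisors are congruent to 1 modulo 4. Moreover, for every positive integer n the number of (x,y,z) ∈ ℤ³ with x²+y²+z² = 8n+5 and the same congruence conditions x ≡ 1 (mod 2), y ≡ 0 (mod 2), z ≡ 2 (mod 4) is positive. -/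
/-- Davenport–Cassels: an integer that is a sum of three rational squares is a sum of three
integer squares. -/
theorem exists_sum_three_sq_of_mul_sq {N x y z t : ℤ} (ht : t ≠ 0)
    (h : x ^ 2 + y ^ 2 + z ^ 2 = N * t ^ 2) :
    ∃ a b c : ℤ, a ^ 2 + b ^ 2 + c ^ 2 = N := by
  induction hk : t.natAbs using Nat.strong_induction_on generalizing x y z t with
  | _ k ih =>
  have near : ∀ u : ℤ, ∃ v : ℤ, 4 * (u - t * v) ^ 2 ≤ t ^ 2 := by
    intro u
    refine ⟨round ((u : ℚ) / t), ?_⟩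
    have ht' : (t : ℚ) ≠ 0 := by exact_mod_cast ht
    have h1 := abs_sub_round ((u : ℚ) / t)
    have h2 : ((u : ℚ) / t - round ((u : ℚ) / t)) ^ 2 ≤ (1 / 2) ^ 2 :=
      sq_le_sq' (by linarith [(abs_le.mp h1).1]) (abs_le.mp h1).2
    have h3 : (u : ℚ) - t * round ((u : ℚ) / t) = t * ((u : ℚ) / t - round ((u : ℚ) / t)) := by
      field_simp
    have h4 : 4 * ((u : ℚ) - t * round ((u : ℚ) / t)) ^ 2 ≤ (t : ℚ) ^ 2 := by
      rw [h3, mul_pow]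
      nlinarith [sq_nonneg (t : ℚ)]
    exact_mod_cast h4
  obtain ⟨u, hu⟩ := near x
  obtain ⟨v, hv⟩ := near y
  obtain ⟨w, hw⟩ := near z
  have htpos : 0 < t ^ 2 := by positivity
  set a := u ^ 2 + v ^ 2 + w ^ 2 - N with ha
  set b := 2 * (N * t - (x * u + y * v + z * w)) with hb
  have key : t * (a * t + b) = (x - t * u) ^ 2 + (y - t * v) ^ 2 + (z - t * w) ^ 2 := by
    rw [ha, hb]; linear_combination -h
  by_cases h0 : a * t + b = 0
  · rw [h0, mul_zero] at key
    have h1 : x - t * u = 0 := by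
      apply pow_eq_zero_iff two_ne_zero |>.mp
      linarith [sq_nonneg (x - t * u), sq_nonneg (y - t * v), sq_nonneg (z - t * w)]
    have h2 : y - t * v = 0 := by
      apply pow_eq_zero_iff two_ne_zero |>.mp
      linarith [sq_nonneg (x - t * u), sq_nonneg (y - t * v), sq_nonneg (z - t * w)]
    have h3 : z - t * w = 0 := by
      apply pow_eq_zero_iff two_ne_zero |>.mp
      linarith [sq_nonneg (x - t * u), sq_nonneg (y - t * v), sq_nonneg (z - t * w)]
    refine ⟨u, v, w, ?_⟩
    have : t ^ 2 * (u ^ 2 + v ^ 2 + w ^ 2) = t ^ 2 * N := by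
      rw [sub_eq_zero.mp h1, sub_eq_zero.mp h2, sub_eq_zero.mp h3] at h
      linear_combination h
    exact mul_left_cancel₀ htpos.ne' this
  · refine ih (a * t + b).natAbs ?_ (x := a * x + b * u) (y := a * y + b * v)
      (z := a * z + b * w) h0 ?_ rfl
    · rw [← hk]
      have h1 : |t| * |a * t + b| < |t| * |t| := by
        rw [← abs_mul, key, abs_of_nonneg (by positivity), abs_mul_abs_self]
        nlinarith
      have h2 : |a * t + b| < |t| := lt_of_mul_lt_mul_left h1 (abs_nonneg t)
      rw [Int.abs_eq_natAbs, Int.abs_eq_natAbs] at h2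
      exact_mod_cast h2
    · have e : b = 2 * (N * t - (x * u + y * v + z * w)) := hb
      have e2 : u ^ 2 + v ^ 2 + w ^ 2 = N + a := by rw [ha]; ring
      linear_combination a ^ 2 * h + b ^ 2 * e2 - a * b * e

open NumberTheorySymbols

/-- A nonsquare `N ≡ 1 mod 4` is a non-residue modulo some prime `p ≡ 3 mod 4`. -/
theorem exists_prime_three_mod_four_jacobiSym_eq_neg_one {N : ℕ} (hN : N % 4 = 1)
    (hsq : ¬IsSquare N) : ∃ p : ℕ, p.Prime ∧ p % 4 = 3 ∧ J((N : ℤ) | p) = -1 := by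
  have hN0 : N ≠ 0 := by rintro rfl; simp at hN
  obtain ⟨l, hl, hodd⟩ : ∃ l : ℕ, l.Prime ∧ Odd (N.factorization l) := by
    by_contra! H
    apply hsq
    have : ∀ l ∈ N.factorization.support, Even (N.factorization l) := fun l hl =>
      Nat.not_odd_iff_even.mp (H l (Nat.prime_of_mem_primeFactors (by simpa using hl)))
    rw [← Nat.prod_factorization_pow_eq_self hN0, Finsupp.prod]
    exact Finset.isSquare_prod _ fun l hl => (this l hl).isSquare_pow l
  have := Fact.mk hl
  have hl2 : l ≠ 2 := by
    rintro rfl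
    have : 2 ∣ N := Nat.dvd_of_factorization_pos (by rintro h; rw [h] at hodd; simp at hodd)
    omega
  set e := N.factorization l with he
  set M := N / l ^ e with hM
  have hNM : l ^ e * M = N := Nat.ordProj_mul_ordCompl_eq_self N l
  have hcop : Nat.Coprime l M := Nat.coprime_ordCompl hl hN0
  have hM0 : M ≠ 0 := by rintro h; rw [h] at hNM; omega
  have hMo : M % 2 = 1 := by
    have : Odd (l ^ e * M) := by rw [hNM, Nat.odd_iff]; omega
    exact Nat.odd_iff.mp (Nat.odd_mul.mp this).2
  obtain ⟨c, hc⟩ : ∃ c : ZMod l, ¬IsSquare c := FiniteField.exists_nonsquare (by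
    rw [ZMod.ringChar_zmod_n]; exact hl2)
  have hlo : Odd l := hl.odd_of_ne_two hl2
  have hco1 : Nat.Coprime l (4 * M) := by
    refine Nat.Coprime.mul_right ?_ hcop
    exact (Nat.coprime_two_right.mpr hlo).pow_right 2
  have hco2 : Nat.Coprime 4 M := (Nat.coprime_two_left.mpr (Nat.odd_iff.mpr hMo)).pow_left 2
  obtain ⟨s, hs4, hsM⟩ := Nat.chineseRemainder hco2 3 1
  obtain ⟨s', hsl, hs'⟩ := Nat.chineseRemainder hco1 c.val s
  have h4 : s' ≡ 3 [MOD 4] := (hs'.of_mul_right M).trans hs4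
  have hM1 : s' ≡ 1 [MOD M] := (hs'.of_mul_left 4).trans hsM
  have hc' : ((s' : ℕ) : ZMod l) = c := by
    rw [(ZMod.natCast_eq_natCast_iff _ _ _).mpr hsl, ZMod.natCast_zmod_val]
  have hunit : s'.Coprime (l * (4 * M)) := by
    refine Nat.Coprime.mul_right ?_ (Nat.Coprime.mul_right ?_ ?_)
    · refine ((Nat.Prime.coprime_iff_not_dvd hl).mpr fun h => hc ?_).symm
      rw [← hc', (ZMod.natCast_eq_zero_iff _ _).mpr h]
      exact IsSquare.zero
    · have := h4.gcd_eq; rw [Nat.Coprime, this]; rfl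
    · have := hM1.gcd_eq; rw [Nat.Coprime, this]; simp
  obtain ⟨p, -, hp, hpm⟩ := Nat.forall_exists_prime_gt_and_modEq 0 (by
    have := hl.pos; positivity) hunit
  have hp4 : p ≡ 3 [MOD 4] := ((hpm.of_mul_left l).of_mul_right M).trans h4
  have hpM : p ≡ 1 [MOD M] := ((hpm.of_mul_left l).of_mul_left 4).trans hM1
  have hpl : ((p : ℕ) : ZMod l) = c := by
    rw [← hc']; exact (ZMod.natCast_eq_natCast_iff _ _ _).mpr (hpm.of_mul_right _)
  have hp4' : p % 4 = 3 := hp4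
  refine ⟨p, hp, hp4', ?_⟩
  rw [jacobiSym.quadratic_reciprocity_one_mod_four hN (Nat.odd_iff.mpr (by omega)), ← hNM,
    jacobiSym.mul_right' _ (pow_ne_zero _ hl.ne_zero) hM0, jacobiSym.pow_right,
    ZMod.nonsquare_iff_jacobiSym_eq_neg_one.mpr (by simpa [hpl] using hc), hodd.neg_one_pow,
    jacobiSym.mod_left' (a₂ := 1) (by exact_mod_cast hpM), jacobiSym.one_left]
  norm_num

/-- For `N ≡ 1 mod 4` there is a prime `q ≡ 1 mod 4` with `q ≡ -1 mod N`, and `N` is a quadratic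
residue modulo every such prime. -/
theorem exists_prime_one_mod_four_mod_eq_neg_one {N : ℕ} (hN : N % 4 = 1) :
    ∃ q : ℕ, q.Prime ∧ N < q ∧ q % 4 = 1 ∧ N ∣ q + 1 ∧ J((N : ℤ) | q) = 1 := by
  have hN0 : N ≠ 0 := by rintro rfl; simp at hN
  have hco : Nat.Coprime 4 N :=
    (Nat.coprime_two_left.mpr (Nat.odd_iff.mpr (by omega))).pow_left 2
  obtain ⟨s, hs4, hsN⟩ := Nat.chineseRemainder hco 1 (N - 1)
  have hN1 : Nat.Coprime (N - 1) N := by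
    rw [Nat.coprime_comm, Nat.coprime_self_sub_right (by omega)]; simp
  have hunit : s.Coprime (4 * N) := by
    refine Nat.Coprime.mul_right ?_ ?_
    · have := hs4.gcd_eq; rw [Nat.Coprime, this]; rfl
    · have := hsN.gcd_eq; rw [Nat.Coprime, this]; exact hN1
  obtain ⟨q, hgt, hq, hqm⟩ := Nat.forall_exists_prime_gt_and_modEq N (by positivity) hunit
  have hq4 : q % 4 = 1 := (hqm.of_mul_right N).trans hs4
  have hqN : q ≡ N - 1 [MOD N] := (hqm.of_mul_left 4).trans hsN
  have hdvd : N ∣ q + 1 := by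
    have := (hqN.add_right 1)
    rw [Nat.sub_add_cancel (by omega)] at this
    exact (Nat.modEq_zero_iff_dvd).mp (this.trans (by simp [Nat.ModEq]))
  refine ⟨q, hq, hgt, hq4, hdvd, ?_⟩
  have hmod : (q : ℤ) % N = (-1) % N := by
    refine Int.ModEq.symm ((Int.modEq_iff_dvd).mpr ?_)
    rw [sub_neg_eq_add]; exact_mod_cast hdvd
  rw [jacobiSym.quadratic_reciprocity_one_mod_four hN (Nat.odd_iff.mpr (by omega)),
    jacobiSym.mod_left' hmod, jacobiSym.at_neg_one (Nat.odd_iff.mpr (by omega)),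
    ZMod.χ₄_nat_one_mod_four hN]

/-- A nonsquare `N ≡ 1 mod 4` is a sum of three rational squares. -/
theorem exists_three_sq_eq_mul_sq {N : ℕ} (hN : N % 4 = 1) (hsq : ¬IsSquare N) :
    ∃ x y z t : ℤ, t ≠ 0 ∧ x ^ 2 + y ^ 2 + z ^ 2 = N * t ^ 2 := by
  obtain ⟨q, hq, hgt, hq4, hNq, hJ⟩ := exists_prime_one_mod_four_mod_eq_neg_one hN
  have := Fact.mk hq
  have hN0 : 0 < N := by omega
  obtain ⟨s, hs⟩ : ∃ s : ℤ, (q : ℤ) ∣ s ^ 2 - N := by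
    obtain ⟨s, hs⟩ := ZMod.isSquare_of_jacobiSym_eq_one hJ
    refine ⟨s.val, ?_⟩
    rw [← ZMod.intCast_zmod_eq_zero_iff_dvd]
    push_cast at hs ⊢
    rw [ZMod.natCast_zmod_val, hs]; ring
  obtain ⟨a, b, hab⟩ := Nat.Prime.sq_add_sq (p := q) (by omega)
  have hab' : (a : ℤ) ^ 2 + (b : ℤ) ^ 2 = q := by exact_mod_cast hab
  -- it is enough to represent `N` by `x² + q w²` over `ℚ`
  suffices H : ∃ x w t : ℤ, t ≠ 0 ∧ x ^ 2 + q * w ^ 2 = N * t ^ 2 by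
    obtain ⟨x, w, t, ht, h⟩ := H
    exact ⟨x, a * w, b * w, t, ht, by rw [← h, ← hab']; ring⟩
  have : NeZero N := ⟨hN0.ne'⟩
  let S := Finset.range (Nat.sqrt (N * q) + 1) ×ˢ Finset.range (Nat.sqrt N + 1) ×ˢ
    Finset.range (Nat.sqrt q + 1)
  let f : ℕ × ℕ × ℕ → ZMod N × ZMod q :=
    fun v => ((v.1 : ZMod N) - v.2.1, (v.1 : ZMod q) - s * v.2.2)
  have hcard : Fintype.card (ZMod N × ZMod q) < S.card := by
    simp only [S, Finset.card_product, Finset.card_range, Fintype.card_prod, ZMod.card]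
    have h1 := Nat.lt_succ_sqrt (N * q)
    have h2 := Nat.lt_succ_sqrt N
    have h3 := Nat.lt_succ_sqrt q
    simp only [Nat.succ_eq_add_one] at h1 h2 h3
    have h4 : N * q < (N.sqrt + 1) * (N.sqrt + 1) * ((q.sqrt + 1) * (q.sqrt + 1)) :=
      Nat.mul_lt_mul'' h2 h3
    refine lt_of_pow_lt_pow_left₀ 2 (Nat.zero_le _) ?_
    calc (N * q) ^ 2 = (N * q) * (N * q) := sq _
      _ < _ := Nat.mul_lt_mul'' h1 h4
      _ = _ := by ring
  obtain ⟨u, hu, v, hv, huv, hfuv⟩ := Finset.exists_ne_map_eq_of_card_lt_of_maps_to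
    (s := S) (t := Finset.univ) (f := f) (by simpa using hcard)
    (fun _ _ => Finset.mem_coe.mpr (Finset.mem_univ _))
  obtain ⟨u1, u2, u3⟩ := u
  obtain ⟨v1, v2, v3⟩ := v
  simp only [S, Finset.mem_product, Finset.mem_range, Nat.lt_add_one_iff] at hu hv
  simp only [f, Prod.mk.injEq] at hfuv
  have bound : ∀ {m n k : ℕ}, m ≤ Nat.sqrt k → n ≤ Nat.sqrt k → ((m : ℤ) - n) ^ 2 ≤ k := by
    intro m n k hm hn
    have hk : ((Nat.sqrt k : ℕ) : ℤ) ^ 2 ≤ k := by exact_mod_cast Nat.sqrt_le' k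
    refine le_trans (sq_le_sq' ?_ ?_) hk <;> omega
  have hx := bound hu.1 hv.1
  have hw := bound hu.2.1 hv.2.1
  have ht := bound hu.2.2 hv.2.2
  have hne : ¬ ((u1 : ℤ) - v1 = 0 ∧ (u2 : ℤ) - v2 = 0 ∧ (u3 : ℤ) - v3 = 0) := by
    rintro ⟨h1, h2, h3⟩
    apply huv
    simp only [Prod.mk.injEq]
    omega
  have hd1 : (N : ℤ) ∣ ((u1 : ℤ) - v1) - ((u2 : ℤ) - v2) := by
    rw [← ZMod.intCast_zmod_eq_zero_iff_dvd]; push_cast; linear_combination hfuv.1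
  have hd2 : (q : ℤ) ∣ ((u1 : ℤ) - v1) - s * ((u3 : ℤ) - v3) := by
    rw [← ZMod.intCast_zmod_eq_zero_iff_dvd]; push_cast; linear_combination hfuv.2
  generalize (u1 : ℤ) - v1 = x at *
  generalize (u2 : ℤ) - v2 = w at *
  generalize (u3 : ℤ) - v3 = t at *
  have hqZ : (0 : ℤ) < q := by exact_mod_cast hq.pos
  have hNZ : (0 : ℤ) < N := by exact_mod_cast hN0
  have hw' : w ^ 2 < N := lt_of_le_of_ne hw fun h => hsq ⟨w.natAbs, by
    zify; rw [← h, sq, abs_mul_abs_self]⟩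
  have ht' : t ^ 2 < q := lt_of_le_of_ne ht fun h => hq.prime.not_isSquare ⟨t.natAbs, by
    zify; rw [← h, sq, abs_mul_abs_self]⟩
  have hcop : IsCoprime (N : ℤ) (q : ℤ) := by
    rw [Nat.isCoprime_iff_coprime]
    exact ((Nat.Prime.coprime_iff_not_dvd hq).mpr fun h => by
      have := Nat.le_of_dvd hN0 h; omega).symm
  have hdN : (N : ℤ) ∣ x ^ 2 + q * w ^ 2 - N * t ^ 2 := by
    obtain ⟨k, hk⟩ := hd1
    obtain ⟨j, hj⟩ := hNq
    have hj' : (q : ℤ) + 1 = N * j := by exact_mod_cast hj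
    exact ⟨k * (x + w) + j * w ^ 2 - t ^ 2, by linear_combination (x + w) * hk + w ^ 2 * hj'⟩
  have hdq : (q : ℤ) ∣ x ^ 2 + q * w ^ 2 - N * t ^ 2 := by
    obtain ⟨k, hk⟩ := hd2
    obtain ⟨j, hj⟩ := hs
    exact ⟨k * (x + s * t) + j * t ^ 2 + w ^ 2, by
      linear_combination (x + s * t) * hk + t ^ 2 * hj⟩
  obtain ⟨k, hk⟩ := hcop.mul_dvd hdN hdq
  have hP : (0 : ℤ) < N * q := by positivity
  push_cast at hx
  have hk0 : -1 < k := by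
    have : (N : ℤ) * q * (-1) < N * q * k := by
      rw [← hk]
      linarith [sq_nonneg x, mul_nonneg hqZ.le (sq_nonneg w), mul_lt_mul_of_pos_left ht' hNZ]
    exact lt_of_mul_lt_mul_left this hP.le
  have hk2 : k < 2 := by
    have : (N : ℤ) * q * k < N * q * 2 := by
      rw [← hk]
      linarith [mul_nonneg hNZ.le (sq_nonneg t), mul_lt_mul_of_pos_left hw' hqZ]
    exact lt_of_mul_lt_mul_left this hP.le
  obtain rfl | rfl : k = 0 ∨ k = 1 := by omega
  · refine ⟨x, w, t, ?_, by linear_combination hk⟩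
    rintro rfl
    apply hne
    have h0 : x ^ 2 + q * w ^ 2 = 0 := by linear_combination hk
    have h1 : x ^ 2 = 0 := by linarith [sq_nonneg x, mul_nonneg hqZ.le (sq_nonneg w)]
    have h2 : w ^ 2 = 0 := by simpa [h1, hq.ne_zero] using h0
    exact ⟨by simpa using h1, by simpa using h2, rfl⟩
  · refine ⟨x * t + q * w, x - w * t, t ^ 2 + q, by positivity, ?_⟩
    linear_combination (t ^ 2 + q) * hk

open scoped Quaternion

theorem Int.exists_modEq_sq_four_mul_lt {m : ℤ} (hm : Odd m) (hpos : 0 < m) (a : ℤ) :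
    ∃ b : ℤ, m ∣ a - b ∧ 4 * b ^ 2 < m ^ 2 := by
  obtain ⟨h, rfl⟩ := hm
  have h1 := Int.emod_add_mul_ediv (a + h) (2 * h + 1)
  have h2 := Int.emod_nonneg (a + h) hpos.ne'
  have h3 := Int.emod_lt_of_pos (a + h) hpos
  refine ⟨(a + h) % (2 * h + 1) - h, ⟨(a + h) / (2 * h + 1), by linarith⟩, ?_⟩
  nlinarith

/-- The integral quaternion with the given components. -/
def Quaternion.ofInts (a b c d : ℤ) : ℍ[ℤ] := ⟨a, b, c, d⟩

section
variable (a b c d : ℤ)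

@[simp] theorem Quaternion.re_ofInts : (ofInts a b c d).re = a := rfl
@[simp] theorem Quaternion.imI_ofInts : (ofInts a b c d).imI = b := rfl
@[simp] theorem Quaternion.imJ_ofInts : (ofInts a b c d).imJ = c := rfl
@[simp] theorem Quaternion.imK_ofInts : (ofInts a b c d).imK = d := rfl

end

/-- Every integral quaternion has a small residue modulo an odd integer. -/
theorem Quaternion.exists_residue {m : ℤ} (hm : Odd m) (hpos : 0 < m) (α : ℍ[ℤ]) :
    ∃ β δ : ℍ[ℤ], α = β + m • δ ∧ normSq β < m ^ 2 := by
  obtain ⟨b0, ⟨d0, h0⟩, l0⟩ := Int.exists_modEq_sq_four_mul_lt hm hpos α.re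
  obtain ⟨b1, ⟨d1, h1⟩, l1⟩ := Int.exists_modEq_sq_four_mul_lt hm hpos α.imI
  obtain ⟨b2, ⟨d2, h2⟩, l2⟩ := Int.exists_modEq_sq_four_mul_lt hm hpos α.imJ
  obtain ⟨b3, ⟨d3, h3⟩, l3⟩ := Int.exists_modEq_sq_four_mul_lt hm hpos α.imK
  refine ⟨ofInts b0 b1 b2 b3, ofInts d0 d1 d2 d3, ?_, ?_⟩
  · apply Quaternion.ext <;> simp <;> linarith
  · rw [normSq_def']; simp only [re_ofInts, imI_ofInts, imJ_ofInts, imK_ofInts]; linarith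

/-- If `normSq α` is even, then some quaternion of norm `2` times `α` is divisible by `2`. -/
theorem Quaternion.exists_mul_eq_two_smul {α : ℍ[ℤ]} (h : Even (normSq α)) :
    ∃ u δ : ℍ[ℤ], normSq u = 2 ∧ u * α = (2 : ℤ) • δ := by
  have half : ∀ u : ℍ[ℤ], normSq u = 2 → 2 ∣ (u * α).re → 2 ∣ (u * α).imI →
      2 ∣ (u * α).imJ → 2 ∣ (u * α).imK → ∃ u δ : ℍ[ℤ], normSq u = 2 ∧ u * α = (2 : ℤ) • δ := by
    rintro u hu ⟨k0, h0⟩ ⟨k1, h1⟩ ⟨k2, h2⟩ ⟨k3, h3⟩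
    exact ⟨u, ofInts k0 k1 k2 k3, hu, Quaternion.ext _ _
      (by simp only [h0, re_smul, re_ofInts, smul_eq_mul])
      (by simp only [h1, imI_smul, imI_ofInts, smul_eq_mul])
      (by simp only [h2, imJ_smul, imJ_ofInts, smul_eq_mul])
      (by simp only [h3, imK_smul, imK_ofInts, smul_eq_mul])⟩
  rw [normSq_def'] at h
  simp only [Int.even_add, Int.even_pow' two_ne_zero] at h
  simp only [Int.even_iff] at h
  by_cases hb : (α.re + α.imI) % 2 = 0
  · apply half (ofInts 1 1 0 0) (by simp [normSq_def']) <;> simp <;> omega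
  by_cases hc : (α.re + α.imJ) % 2 = 0
  · apply half (ofInts 1 0 1 0) (by simp [normSq_def']) <;> simp <;> omega
  · apply half (ofInts 1 0 0 1) (by simp [normSq_def']) <;> simp <;> omega

section
variable {p : ℕ} {r : ℤ} {v : ℍ[ℤ]}

theorem Quaternion.dvd_of_dvd_smul {p k : ℤ} (hk : IsCoprime p k) {a b : ℍ[ℤ]}
    (h : k • a = p • b) : ∃ c : ℍ[ℤ], a = p • c := by
  obtain ⟨x, y, hxy⟩ := hk
  refine ⟨x • a + y • b, ?_⟩
  rw [smul_add, smul_comm p y, ← h, smul_smul, smul_smul, ← add_smul, mul_comm p x, hxy, one_smul]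

theorem Quaternion.normSq_int_smul (k : ℤ) (a : ℍ[ℤ]) : normSq (k • a) = k ^ 2 * normSq a := by
  simp only [normSq_def', re_smul, imI_smul, imJ_smul, imK_smul, smul_eq_mul]; ring

/-- Descent: the left ideal `{α | α v ≡ r α mod p}` contains an element of norm `p`
as soon as it contains one whose norm is a small multiple of `p`. -/
theorem Quaternion.exists_normSq_eq_prime_of_lt (hp : p.Prime) (hp2 : p ≠ 2) (k : ℕ) (hk : 0 < k)
    (hkp : k < p) {α β : ℍ[ℤ]} (hα : α * v - r • α = (p : ℤ) • β) (hn : normSq α = k * p) :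
    ∃ α β : ℍ[ℤ], α * v - r • α = (p : ℤ) • β ∧ normSq α = p := by
  induction k using Nat.strong_induction_on generalizing α β with
  | _ k ih =>
  have hcop : IsCoprime (p : ℤ) (k : ℤ) := by
    rw [Nat.isCoprime_iff_coprime, hp.coprime_iff_not_dvd]
    exact fun h => absurd (Nat.le_of_dvd hk h) (by omega)
  have hp0 : (0 : ℤ) < p := by exact_mod_cast hp.pos
  obtain rfl | hk1 := eq_or_ne k 1
  · exact ⟨α, β, hα, by simpa using hn⟩
  have step : ∀ {m : ℤ} {γ δ : ℍ[ℤ]}, IsCoprime (p : ℤ) m → γ * α = m • δ →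
      ∃ β, δ * v - r • δ = (p : ℤ) • β := by
    intro m γ δ hm h
    apply dvd_of_dvd_smul hm (b := γ * β)
    rw [smul_sub, smul_comm m r, ← smul_mul_assoc, ← h, mul_assoc, ← mul_smul_comm, ← mul_sub, hα,
      mul_smul_comm]
  rcases Nat.even_or_odd k with he | ho
  · obtain ⟨j, hj⟩ := he
    obtain ⟨u, δ, hu, hδ⟩ := exists_mul_eq_two_smul (α := α)
      (by rw [hn, hj]; push_cast; exact ⟨j * p, by ring⟩)
    obtain ⟨β', hβ'⟩ := step (by
      have : Nat.Coprime p 2 := (Nat.coprime_primes hp Nat.prime_two).mpr hp2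
      exact_mod_cast Nat.isCoprime_iff_coprime.mpr this) hδ
    refine ih j (by omega) (by omega) (by omega) hβ' ?_
    have := congrArg normSq hδ
    rw [map_mul, hu, hn, normSq_int_smul, hj] at this
    push_cast at this
    linarith
  · have hk0 : (0 : ℤ) < k := by exact_mod_cast hk
    obtain ⟨γ, δ, hγ, hlt⟩ := exists_residue (m := k) (by exact_mod_cast ho) hk0 (star α)
    have hmul : γ * α = (k : ℤ) • ((p : ℍ[ℤ]) - δ * α) := by
      have h1 : star α * α = ((k * p : ℤ) : ℍ[ℤ]) := by rw [star_mul_self, hn]; norm_cast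
      rw [hγ, add_mul, smul_mul_assoc] at h1
      rw [smul_sub, eq_sub_iff_add_eq, h1, zsmul_eq_mul]
      push_cast; rfl
    obtain ⟨β', hβ'⟩ := step hcop hmul
    have hnn := congrArg normSq hmul
    rw [map_mul, hn, normSq_int_smul] at hnn
    set ε := (p : ℍ[ℤ]) - δ * α with hε
    have hnn' : normSq γ * p = k * normSq ε := by
      apply mul_left_cancel₀ hk0.ne'; linear_combination hnn
    obtain ⟨j, hj⟩ := hcop.symm.dvd_of_dvd_mul_right (Dvd.intro _ hnn'.symm)
    have hγ0 : 0 < normSq γ := by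
      refine lt_of_le_of_ne normSq_nonneg fun h0 => ?_
      rw [eq_comm, normSq_eq_zero] at h0
      have := congrArg normSq hγ
      rw [h0, zero_add, normSq_star, hn, normSq_int_smul] at this
      have hd : (p : ℤ) = k * normSq δ := by
        apply mul_left_cancel₀ hk0.ne'; linear_combination this
      have hd' : k ∣ p := by exact_mod_cast Dvd.intro _ hd.symm
      rcases (Nat.dvd_prime hp).mp hd' with h | h <;> omega
    have hj0 : 0 < j := pos_of_mul_pos_right (hj ▸ hγ0) hk0.le
    have hjk : j < k := by
      refine lt_of_mul_lt_mul_left ?_ hk0.le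
      rw [← hj, ← sq]; exact hlt
    lift j to ℕ using hj0.le
    refine ih j (by exact_mod_cast hjk) (by exact_mod_cast hj0) (by omega) hβ' ?_
    apply mul_left_cancel₀ hk0.ne'
    rw [← hnn', hj]; ring

end

/-- If `-normSq v` is a nonzero square modulo the odd prime `p`, conjugation of the pure
quaternion `v` by some integral quaternion of norm `p` is integral. -/
theorem Quaternion.exists_normSq_eq_prime_conj {p : ℕ} (hp : p.Prime) (hp2 : p ≠ 2) {r : ℤ}
    {v : ℍ[ℤ]} (hv : v.re = 0) (hr : ¬ (p : ℤ) ∣ r) (h : (p : ℤ) ∣ normSq v + r ^ 2) :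
    ∃ α w : ℍ[ℤ], normSq α = p ∧ α * v * star α = (p : ℤ) • w := by
  have hp0 : (0 : ℤ) < p := by exact_mod_cast hp.pos
  have hpo : Odd (p : ℤ) := by exact_mod_cast hp.odd_of_ne_two hp2
  suffices ∃ α β : ℍ[ℤ], α * v - r • α = (p : ℤ) • β ∧ normSq α = p by
    obtain ⟨α, β, h1, h2⟩ := this
    refine ⟨α, β * star α + (r : ℍ[ℤ]), h2, ?_⟩
    rw [sub_eq_iff_eq_add] at h1
    rw [h1, add_mul, smul_mul_assoc, smul_mul_assoc, self_mul_star, h2, smul_add]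
    congr 1
    rw [zsmul_eq_mul, zsmul_eq_mul]
    have := congrArg (fun z : ℤ => (z : ℍ[ℤ])) (mul_comm r p)
    push_cast at this ⊢
    exact this
  obtain ⟨α, δ, hα, hlt⟩ := exists_residue hpo hp0 (v + (r : ℍ[ℤ]))
  obtain ⟨c, hc⟩ := h
  have hmem : (v + (r : ℍ[ℤ])) * v - r • (v + (r : ℍ[ℤ])) = (p : ℤ) • ((-c : ℤ) : ℍ[ℤ]) := by
    have hs : v * v = ((-normSq v : ℤ) : ℍ[ℤ]) := by
      have h1 := self_mul_star v
      have h2 : star v = -v := by apply Quaternion.ext <;> simp [hv]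
      rw [h2, mul_neg, neg_eq_iff_eq_neg] at h1
      rw [h1]; norm_cast
    rw [zsmul_eq_mul, zsmul_eq_mul, add_mul, mul_add, hs]
    have : -normSq v - r * r = p * (-c) := by linear_combination -hc
    have := congrArg (fun z : ℤ => (z : ℍ[ℤ])) this
    push_cast at this ⊢
    rw [← this]; abel
  have hmem' : α * v - r • α = (p : ℤ) • (((-c : ℤ) : ℍ[ℤ]) - (δ * v - r • δ)) := by
    rw [smul_sub, ← hmem, hα, smul_sub, add_mul, smul_add, smul_mul_assoc, smul_comm r (p : ℤ)]
    abel
  have e : α = v + (r : ℍ[ℤ]) - (p : ℤ) • δ := by rw [hα]; abel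
  have hdvd : (p : ℤ) ∣ normSq α := by
    rw [e]
    rw [normSq_def'] at hc ⊢
    simp [hv] at hc ⊢
    refine ⟨c - 2 * (r * δ.re + v.imI * δ.imI + v.imJ * δ.imJ + v.imK * δ.imK)
      + p * (δ.re ^ 2 + δ.imI ^ 2 + δ.imJ ^ 2 + δ.imK ^ 2), ?_⟩
    linear_combination hc
  obtain ⟨k, hk⟩ := hdvd
  have hpos : 0 < normSq α := by
    refine lt_of_le_of_ne normSq_nonneg fun h0 => hr ?_
    rw [eq_comm, normSq_eq_zero] at h0
    rw [h0, zero_add] at hα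
    have := congrArg (·.re) hα
    simp [hv] at this
    exact ⟨_, this⟩
  have hk0 : 0 < k := pos_of_mul_pos_right (hk ▸ hpos) hp0.le
  have hkp : k < p := by
    refine lt_of_mul_lt_mul_left ?_ hp0.le
    rw [← hk, ← sq]; exact hlt
  lift k to ℕ using hk0.le
  exact exists_normSq_eq_prime_of_lt hp hp2 k (by exact_mod_cast hk0) (by exact_mod_cast hkp)
    hmem' (by rw [hk]; ring)

theorem ZMod.four_sum_sq_eq_three : ∀ a b c d : ZMod 4, a ^ 2 + b ^ 2 + c ^ 2 + d ^ 2 = 3 →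
    2 * (b * d - a * c) = 2 := by decide

/-- Conjugation by a quaternion of norm `p ≡ 3 mod 4` exchanges representations of `N` whose even
entries are `0 mod 4` and `2 mod 4`. -/
theorem exists_sq_add_sq_mod_four_of_jacobiSym {N p : ℕ} (hp : p.Prime) (hp4 : p % 4 = 3)
    (hJ : J((N : ℤ) | p) = -1) {x y z : ℤ} (h : x ^ 2 + y ^ 2 + z ^ 2 = N) (hx : x % 2 = 1)
    (hy : y % 4 = 0) (hz : z % 4 = 0) :
    ∃ x y z : ℤ, x ^ 2 + y ^ 2 + z ^ 2 = N ∧ x % 2 = 1 ∧ y % 2 = 0 ∧ z % 4 = 2 := by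
  have := Fact.mk hp
  obtain ⟨r, hr⟩ : ∃ r : ℤ, (p : ℤ) ∣ N + r ^ 2 := by
    have hJ' : J(-(N : ℤ) | p) = 1 := by
      rw [jacobiSym.neg _ (Nat.odd_iff.mpr (by omega)), hJ, ZMod.χ₄_nat_three_mod_four hp4]
      norm_num
    obtain ⟨s, hs⟩ := ZMod.isSquare_of_jacobiSym_eq_one hJ'
    refine ⟨s.val, ?_⟩
    rw [← ZMod.intCast_zmod_eq_zero_iff_dvd]
    push_cast at hs ⊢
    rw [ZMod.natCast_zmod_val, sq, ← hs]; ring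
  have hpr : ¬ (p : ℤ) ∣ r := by
    intro hd
    have hpN : (p : ℤ) ∣ N := (dvd_add_left (dvd_pow hd two_ne_zero)).mp hr
    have h0 : J((N : ℤ) | p) = 0 := by
      rw [jacobiSym.eq_zero_iff_not_coprime, Int.gcd_natCast_natCast,
        Nat.gcd_eq_right (Int.natCast_dvd_natCast.mp hpN)]
      exact hp.ne_one
    omega
  obtain ⟨α, w, hα, hw⟩ := Quaternion.exists_normSq_eq_prime_conj (v := Quaternion.ofInts 0 x y z)
    hp (by omega) rfl hpr (by
      rw [Quaternion.normSq_def']; simpa [h] using hr)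
  have hp0 : (p : ℤ) ≠ 0 := by exact_mod_cast hp.ne_zero
  have hnw : Quaternion.normSq w = N := by
    have := congrArg Quaternion.normSq hw
    rw [map_mul, map_mul, Quaternion.normSq_star, hα, Quaternion.normSq_int_smul,
      Quaternion.normSq_def' (Quaternion.ofInts 0 x y z)] at this
    simp [h] at this
    apply mul_left_cancel₀ (pow_ne_zero 2 hp0)
    linear_combination -this
  have h0 := congrArg (·.re) hw
  have h1 := congrArg (·.imI) hw
  have h2 := congrArg (·.imJ) hw
  have h3 := congrArg (·.imK) hw
  simp at h0 h1 h2 h3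
  rw [Quaternion.normSq_def'] at hα hnw
  have hw0 : w.re = 0 := by
    apply mul_left_cancel₀ hp0
    linear_combination -h0
  rw [hw0] at hnw
  generalize α.re = a at *
  generalize α.imI = b at *
  generalize α.imJ = c at *
  generalize α.imK = d at *
  obtain ⟨y, rfl⟩ : (4 : ℤ) ∣ y := Int.dvd_of_emod_eq_zero hy
  obtain ⟨z, rfl⟩ : (4 : ℤ) ∣ z := Int.dvd_of_emod_eq_zero hz
  obtain ⟨x, rfl⟩ : ∃ k, x = 2 * k + 1 := ⟨x / 2, by omega⟩
  obtain ⟨m, hm⟩ : ∃ m : ℤ, (p : ℤ) = 4 * m + 3 := ⟨p / 4, by omega⟩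
  obtain ⟨e, he⟩ : ∃ e : ℤ, 2 * (b * d - a * c) = 4 * e + 2 := by
    have := ZMod.four_sum_sq_eq_three a b c d (by
      have := congrArg (Int.cast : ℤ → ZMod 4) (hα.trans hm)
      push_cast at this
      rw [this, show (4 : ZMod 4) = 0 from rfl]; ring)
    have h4 : ((2 * (b * d - a * c) - 2 : ℤ) : ZMod 4) = 0 := by push_cast; rw [this]; ring
    obtain ⟨e, he⟩ := (ZMod.intCast_zmod_eq_zero_iff_dvd _ 4).mp h4
    exact ⟨e, by push_cast at he; linarith⟩
  have e1 : ∃ s : ℤ, w.imI = 2 * s + 1 := by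
    refine ⟨p * x - (c ^ 2 + d ^ 2) * (2 * x + 1) + 4 * ((b * c - a * d) * y + (b * d + a * c) * z)
      + 2 * m + 1 - (2 * m + 1) * w.imI, ?_⟩
    linear_combination -h1 + (2 * x + 1) * hα + (1 - w.imI) * hm
  have e2 : ∃ s : ℤ, w.imJ = 2 * s := by
    refine ⟨(b * c + a * d) * (2 * x + 1) + 2 * ((a ^ 2 - b ^ 2 + c ^ 2 - d ^ 2) * y)
      + 4 * ((c * d - a * b) * z) - (2 * m + 1) * w.imJ, ?_⟩
    linear_combination -h2 - w.imJ * hm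
  have e3 : ∃ s : ℤ, 3 * w.imK = 4 * s + 2 := by
    refine ⟨e * (2 * x + 1) + x + (a ^ 2 - b ^ 2 - c ^ 2 + d ^ 2) * z
      + 2 * ((c * d + a * b) * y) - m * w.imK, ?_⟩
    linear_combination -h3 + (2 * x + 1) * he - w.imK * hm
  refine ⟨w.imI, w.imJ, w.imK, by linarith, ?_, ?_, ?_⟩
  · obtain ⟨s, hs⟩ := e1; omega
  · obtain ⟨s, hs⟩ := e2; omega
  · obtain ⟨s, hs⟩ := e3; omega

theorem exists_sum_three_sq {N : ℕ} (hN : N % 4 = 1) (hsq : ¬IsSquare N) :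
    ∃ x y z : ℤ, x ^ 2 + y ^ 2 + z ^ 2 = N := by
  obtain ⟨x, y, z, t, ht, h⟩ := exists_three_sq_eq_mul_sq hN hsq
  exact exists_sum_three_sq_of_mul_sq ht h

theorem Int.sq_mod_eight (x : ℤ) : (x % 2 = 1 ∧ x ^ 2 % 8 = 1) ∨ (x % 4 = 0 ∧ x ^ 2 % 8 = 0) ∨
    (x % 4 = 2 ∧ x ^ 2 % 8 = 4) := by
  have h : x % 8 = 0 ∨ x % 8 = 1 ∨ x % 8 = 2 ∨ x % 8 = 3 ∨ x % 8 = 4 ∨ x % 8 = 5 ∨ x % 8 = 6 ∨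
    x % 8 = 7 := by omega
  rcases h with h | h | h | h | h | h | h | h <;> simp [pow_two, Int.mul_emod, h] <;> omega

/-- A sum of three squares that is `1 mod 4` can be ordered with the odd square first, and its
two even entries agree mod `4` exactly when the sum is `1 mod 8`. -/
theorem exists_sq_add_sq_ordered {N : ℕ} (hN : N % 4 = 1)
    (h : ∃ x y z : ℤ, x ^ 2 + y ^ 2 + z ^ 2 = N) :
    ∃ x y z : ℤ, x ^ 2 + y ^ 2 + z ^ 2 = N ∧ x % 2 = 1 ∧ y % 2 = 0 ∧
      (z % 4 = 2 ∨ N % 8 = 1 ∧ y % 4 = 0 ∧ z % 4 = 0) := by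
  obtain ⟨x, y, z, h⟩ := h
  have hx := Int.sq_mod_eight x
  have hy := Int.sq_mod_eight y
  have hz := Int.sq_mod_eight z
  rcases hx with hx | hx | hx <;> rcases hy with hy | hy | hy <;> rcases hz with hz | hz | hz <;>
    first
    | exfalso; omega
    | exact ⟨x, y, z, by linarith, by omega⟩
    | exact ⟨x, z, y, by linarith, by omega⟩
    | exact ⟨y, x, z, by linarith, by omega⟩
    | exact ⟨y, z, x, by linarith, by omega⟩
    | exact ⟨z, x, y, by linarith, by omega⟩
    | exact ⟨z, y, x, by linarith, by omega⟩

theorem exists_sq_add_sq_mod_four_of_not_isSquare {N : ℕ} (hN : N % 4 = 1) (hsq : ¬IsSquare N) :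
    ∃ x y z : ℤ, x ^ 2 + y ^ 2 + z ^ 2 = N ∧ x % 2 = 1 ∧ y % 2 = 0 ∧ z % 4 = 2 := by
  obtain ⟨x, y, z, h, hx, hy, hz | ⟨-, hy4, hz4⟩⟩ :=
    exists_sq_add_sq_ordered hN (exists_sum_three_sq hN hsq)
  · exact ⟨x, y, z, h, hx, hy, hz⟩
  · obtain ⟨p, hp, hp4, hJ⟩ := exists_prime_three_mod_four_jacobiSym_eq_neg_one hN hsq
    exact exists_sq_add_sq_mod_four_of_jacobiSym hp hp4 hJ h hx hy4 hz4

theorem exists_sq_add_sq_mod_four_of_dvd {M m : ℕ} (hM : M % 2 = 1) (hm : m % 4 = 3)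
    (hdvd : m ∣ M) :
    ∃ x y z : ℤ, x ^ 2 + y ^ 2 + z ^ 2 = (M : ℤ) ^ 2 ∧ x % 2 = 1 ∧ y % 2 = 0 ∧ z % 4 = 2 := by
  obtain ⟨k, rfl⟩ := hdvd
  have hk : (k : ℤ) % 2 = 1 := by
    have := (Nat.odd_mul.mp (Nat.odd_iff.mpr hM)).2
    have := Nat.odd_iff.mp this
    omega
  suffices H : ∃ x y z : ℤ, x ^ 2 + y ^ 2 + z ^ 2 = (m : ℤ) ^ 2 ∧ x % 2 = 1 ∧ y % 2 = 0 ∧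
      z % 4 = 2 by
    obtain ⟨x, y, z, h, hx, hy, hz⟩ := H
    refine ⟨k * x, k * y, k * z, by push_cast; linear_combination (k : ℤ) ^ 2 * h, ?_, ?_, ?_⟩
    · simp [Int.mul_emod, hx, hk]
    · simp [Int.mul_emod, hy]
    · have : (k : ℤ) % 4 = 1 ∨ (k : ℤ) % 4 = 3 := by omega
      rcases this with h4 | h4 <;> simp [Int.mul_emod, hz, h4]
  obtain ⟨a, b, c, d, h⟩ := Nat.sum_four_squares m
  have hZ : (a : ℤ) ^ 2 + (b : ℤ) ^ 2 + (c : ℤ) ^ 2 + (d : ℤ) ^ 2 = m := by exact_mod_cast h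
  -- the pure quaternion obtained by conjugating `i` by `a + bi + cj + dk`
  refine ⟨a ^ 2 + b ^ 2 - c ^ 2 - d ^ 2, 2 * (b * c + a * d), 2 * (b * d - a * c), ?_, ?_, ?_, ?_⟩
  · rw [← hZ]; ring
  · have : (m : ℤ) % 2 = 1 := by omega
    rw [← hZ] at this
    omega
  · omega
  · have h4 : ((m : ℕ) : ZMod 4) = 3 := by
      rw [← ZMod.natCast_mod, hm]; rfl
    have := ZMod.four_sum_sq_eq_three a b c d (by rw [← h4, ← h]; push_cast; rfl)
    have h5 : ((2 * (b * d - a * c) - 2 : ℤ) : ZMod 4) = 0 := by push_cast; rw [this]; ring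
    obtain ⟨e, he⟩ := (ZMod.intCast_zmod_eq_zero_iff_dvd _ 4).mp h5
    push_cast at he
    omega

/-- A divisor `A` of a sum of two squares, all of whose common prime factors with the
complementary divisor are `1 mod 4`, is `1 mod 4` if odd. -/
theorem Nat.mod_four_eq_one_of_mul_eq_sq_add_sq {A B a b : ℕ} (h : A * B = a ^ 2 + b ^ 2)
    (hA : A % 2 = 1) (hB : B ≠ 0) (hAB : ∀ p : ℕ, p.Prime → p ∣ A → p ∣ B → p % 4 = 1) :
    A % 4 = 1 := by
  have hA0 : A ≠ 0 := by rintro rfl; simp at hA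
  have hs : ∃ x y, A = x ^ 2 + y ^ 2 := by
    rw [Nat.eq_sq_add_sq_iff]
    intro q hq hq4
    have hqp := Nat.prime_of_mem_primeFactors hq
    have hqA := Nat.dvd_of_mem_primeFactors hq
    have := Fact.mk hqp
    have hqB : ¬ q ∣ B := fun hd => by have := hAB q hqp hqA hd; omega
    have := Nat.eq_sq_add_sq_iff.mp ⟨a, b, h⟩ q
      (Nat.mem_primeFactors.mpr ⟨hqp, hqA.mul_right B, mul_ne_zero hA0 hB⟩) hq4
    rwa [padicValNat.mul hA0 hB, padicValNat.eq_zero_of_not_dvd hqB, add_zero] at this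
  obtain ⟨x, y, hxy⟩ := hs
  have hx := Int.sq_mod_eight x
  have hy := Int.sq_mod_eight y
  have : (A : ℤ) = (x : ℤ) ^ 2 + (y : ℤ) ^ 2 := by exact_mod_cast hxy
  omega

theorem not_exists_sq_add_sq_mod_four {M : ℕ} (hM0 : 0 < M)
    (hM : ∀ p : ℕ, p.Prime → p ∣ M → p % 4 = 1)
    {x y z : ℤ} (h : x ^ 2 + y ^ 2 + z ^ 2 = (M : ℤ) ^ 2) (hx : x % 2 = 1) (hy : y % 2 = 0)
    (hz : z % 4 = 2) : False := by
  have hM1 : M % 4 = 1 := by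
    clear h
    induction M using Nat.recOnMul with
    | zero => omega
    | one => rfl
    | prime p hp => exact hM p hp dvd_rfl
    | mul a b iha ihb =>
      have ha := iha (Nat.pos_of_mul_pos_right hM0) fun p hp hd => hM p hp (hd.mul_right b)
      have hb := ihb (Nat.pos_of_mul_pos_left hM0) fun p hp hd => hM p hp (hd.mul_left a)
      simp [Nat.mul_mod, ha, hb]
  have hx8 := Int.sq_mod_eight x
  have hM8 := Int.sq_mod_eight M
  have hy8 := Int.sq_mod_eight y
  have hz8 := Int.sq_mod_eight z
  obtain ⟨v, rfl⟩ : ∃ v, y = 2 * v := ⟨y / 2, by omega⟩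
  obtain ⟨w, rfl⟩ : ∃ w, z = 2 * w := ⟨z / 2, by omega⟩
  have hv : v % 2 = 1 := by omega
  have hw : w % 2 = 1 := by omega
  obtain ⟨C, hC⟩ : ∃ C, (M : ℤ) - x = 2 * C := ⟨(M - x) / 2, by omega⟩
  obtain ⟨D, hD⟩ : ∃ D, (M : ℤ) + x = 2 * D := ⟨(M + x) / 2, by omega⟩
  obtain ⟨a, ha⟩ : ∃ a, v + w = 2 * a := ⟨(v + w) / 2, by omega⟩
  obtain ⟨b, hb⟩ : ∃ b, v - w = 2 * b := ⟨(v - w) / 2, by omega⟩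
  obtain rfl : v = a + b := by omega
  obtain rfl : w = a - b := by omega
  have hCD : C * D = 2 * (a ^ 2 + b ^ 2) := by
    have : 4 * (C * D) = 4 * (2 * (a ^ 2 + b ^ 2)) := by
      linear_combination -(D * 2) * hC - (M - x) * hD - h
    linarith
  have hsum : C + D = M := by omega
  have hodd : (a ^ 2 + b ^ 2) % 2 = 1 := by
    have := Int.sq_mod_eight a
    have := Int.sq_mod_eight b
    omega
  have hpos : 0 < a ^ 2 + b ^ 2 := by
    refine lt_of_le_of_ne (by positivity) fun h0 => ?_
    rw [← h0] at hodd; simp at hodd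
  have main : ∀ C D : ℤ, C * D = 2 * (a ^ 2 + b ^ 2) → C + D = M → C % 2 = 0 → False := by
    intro C D hCD hsum hC2
    obtain ⟨E, rfl⟩ : ∃ E, C = 2 * E := ⟨C / 2, by omega⟩
    have hED : E * D = a ^ 2 + b ^ 2 := by linarith
    have hED0 : 0 < E * D := hED ▸ hpos
    have hE : 0 < E := by
      by_contra hcon
      have : D < 0 := by
        by_contra hD
        exact absurd hED0 (not_lt.mpr (mul_nonpos_of_nonpos_of_nonneg (not_lt.mp hcon)
          (not_lt.mp hD)))
      omega
    have hD : 0 < D := pos_of_mul_pos_right hED0 hE.le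
    lift E to ℕ using hE.le
    lift D to ℕ using hD.le
    have hEDn : E * D = a.natAbs ^ 2 + b.natAbs ^ 2 := by
      zify; rw [sq_abs, sq_abs]; exact hED
    have hED2 : E % 2 = 1 ∧ D % 2 = 1 := by
      rw [← hED] at hodd
      have : Odd (E * D) := by rw [Nat.odd_iff]; exact_mod_cast hodd
      exact ⟨Nat.odd_iff.mp (Nat.odd_mul.mp this).1, Nat.odd_iff.mp (Nat.odd_mul.mp this).2⟩
    have hMn : 2 * E + D = M := by exact_mod_cast hsum
    have hcommon : ∀ p : ℕ, p.Prime → p ∣ E → p ∣ D → p % 4 = 1 := fun p hp h1 h2 =>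
      hM p hp (hMn ▸ dvd_add (h1.mul_left 2) h2)
    have h1 := Nat.mod_four_eq_one_of_mul_eq_sq_add_sq hEDn hED2.1 (by omega) hcommon
    have h2 := Nat.mod_four_eq_one_of_mul_eq_sq_add_sq (mul_comm D E ▸ hEDn) hED2.2 (by omega)
      fun p hp h1 h2 => hcommon p hp h2 h1
    omega
  rcases Int.emod_two_eq_zero_or_one C with h0 | h0
  · exact main C D hCD hsum h0
  · exact main D C (by rw [mul_comm, hCD]) (by omega) (by omega)

theorem finite_sum_three_sq_eq (N : ℤ) (P : ℤ × ℤ × ℤ → Prop) :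
    Finite {v : ℤ × ℤ × ℤ // v.1 ^ 2 + v.2.1 ^ 2 + v.2.2 ^ 2 = N ∧ P v} := by
  refine Set.Finite.subset (Set.finite_Icc ((-N, -N, -N) : ℤ × ℤ × ℤ) (N, N, N)) ?_
  rintro ⟨x, y, z⟩ ⟨h, -⟩
  have key : ∀ t : ℤ, t ^ 2 ≤ N → -N ≤ t ∧ t ≤ N := fun t ht =>
    ⟨by nlinarith [Int.le_self_sq (-t)], (Int.le_self_sq t).trans ht⟩
  simp only at h
  have hx := key x (by nlinarith [sq_nonneg y, sq_nonneg z])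
  have hy := key y (by nlinarith [sq_nonneg x, sq_nonneg z])
  have hz := key z (by nlinarith [sq_nonneg y, sq_nonneg x])
  exact ⟨⟨hx.1, hy.1, hz.1⟩, hx.2, hy.2, hz.2⟩

theorem stmt_14 (n : ℕ) (hn : 0 < n) :
    (Nat.card {v : ℤ × ℤ × ℤ //
        v.1 ^ 2 + v.2.1 ^ 2 + v.2.2 ^ 2 = 8 * (n : ℤ) + 1 ∧
        v.1 ≡ 1 [ZMOD 2] ∧ v.2.1 ≡ 0 [ZMOD 2] ∧ v.2.2 ≡ 2 [ZMOD 4]} = 0 ↔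
      ∃ M : ℕ, 0 < M ∧ 8 * n + 1 = M ^ 2 ∧ ∀ p : ℕ, p.Prime → p ∣ M → p % 4 = 1) ∧
    0 < Nat.card {v : ℤ × ℤ × ℤ //
        v.1 ^ 2 + v.2.1 ^ 2 + v.2.2 ^ 2 = 8 * (n : ℤ) + 5 ∧
        v.1 ≡ 1 [ZMOD 2] ∧ v.2.1 ≡ 0 [ZMOD 2] ∧ v.2.2 ≡ 2 [ZMOD 4]} := by
  have hfin := fun N : ℤ => finite_sum_three_sq_eq N fun v =>
    v.1 ≡ 1 [ZMOD 2] ∧ v.2.1 ≡ 0 [ZMOD 2] ∧ v.2.2 ≡ 2 [ZMOD 4]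
  have h1 := hfin (8 * n + 1)
  have h5 := hfin (8 * n + 5)
  refine ⟨⟨fun hcard => ?_, ?_⟩, ?_⟩
  · rw [Finite.card_eq_zero_iff] at hcard
    have hno : ¬ ∃ x y z : ℤ, x ^ 2 + y ^ 2 + z ^ 2 = ((8 * n + 1 : ℕ) : ℤ) ∧ x % 2 = 1 ∧
        y % 2 = 0 ∧ z % 4 = 2 := by
      rintro ⟨x, y, z, h, hx, hy, hz⟩
      exact hcard.false ⟨(x, y, z), by exact_mod_cast h, hx, hy, hz⟩
    have hsq : IsSquare (8 * n + 1) := by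
      by_contra hsq
      exact hno (exists_sq_add_sq_mod_four_of_not_isSquare (by omega) hsq)
    obtain ⟨M, hM⟩ := hsq
    have hM2 : M % 2 = 1 := by
      have : Odd (M * M) := by rw [← hM, Nat.odd_iff]; omega
      exact Nat.odd_iff.mp (Nat.odd_mul.mp this).1
    refine ⟨M, by omega, by rw [hM, sq], fun p hp hpM => ?_⟩
    by_contra hp4
    have hp2 : p % 2 = 1 := Nat.odd_iff.mp ((Nat.odd_iff.mpr hM2).of_dvd_nat hpM)
    refine hno ?_
    rw [hM, ← sq]
    exact_mod_cast exists_sq_add_sq_mod_four_of_dvd hM2 (by omega) hpM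
  · rintro ⟨M, hM0, hM, hp⟩
    rw [Finite.card_eq_zero_iff]
    refine ⟨fun ⟨⟨x, y, z⟩, h, hx, hy, hz⟩ => ?_⟩
    exact not_exists_sq_add_sq_mod_four hM0 hp (h.trans (by exact_mod_cast hM)) hx hy hz
  · have hsq : ¬ IsSquare (8 * n + 5) := by
      rintro ⟨M, hM⟩
      have := Int.sq_mod_eight M
      have h : (8 * n + 5 : ℤ) = (M : ℤ) ^ 2 := by rw [sq]; exact_mod_cast hM
      omega
    obtain ⟨x, y, z, h, hx, hy, hz⟩ :=
      exists_sq_add_sq_mod_four_of_not_isSquare (N := 8 * n + 5) (by omega) hsq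
    rw [Finite.card_pos_iff]
    exact ⟨(x, y, z), by exact_mod_cast h, hx, hy, hz⟩
end

section
/- Let n be a positive integer. Then the number of (x,y,z) ∈ ℤ³ with x²+y²+z² = 8n+1, x ≡ 1 (mod 2), y ≡ 2 (mod 4), and z ≡ 2 (mod 4) is zero if and only if 8n+1 = M² for some positive integer M all of whose prime divisors are congruent to 1 modulo 4. -/
theorem exists_balanced_add_mul (f a : ℤ) (ha : 0 < a) :
    ∃ k : ℤ, -a ≤ 2 * (f + k * a) ∧ 2 * (f + k * a) ≤ a := by
  refine ⟨-((2 * f + a) / (2 * a)), ?_⟩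
  have h1 := Int.emod_add_mul_ediv (2 * f + a) (2 * a)
  have h2 := Int.emod_nonneg (2 * f + a) (b := 2 * a) (by omega)
  have h3 := Int.emod_lt_of_pos (2 * f + a) (b := 2 * a) (by omega)
  constructor <;> linarith

/-- A positive definite integral ternary quadratic form of determinant one takes only values that
are sums of three squares. -/
theorem exists_sum_three_squares_of_det_eq_one (n : ℕ) : ∀ a b c d e f : ℤ, 0 < a →
    0 < a * b - f ^ 2 →
    a * b * c + 2 * d * e * f - a * d ^ 2 - b * e ^ 2 - c * f ^ 2 = 1 →
    a + (a * b - f ^ 2) ≤ n → ∀ x y z : ℤ, ∃ u v w : ℤ,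
      a * x ^ 2 + b * y ^ 2 + c * z ^ 2 + 2 * d * y * z + 2 * e * x * z + 2 * f * x * y
        = u ^ 2 + v ^ 2 + w ^ 2 := by
  induction n with
  | zero => intro a b c d e f ha hC _ hn; push_cast at hn; omega
  | succ n ih =>
    intro a b c d e f ha hC hdet hn x y z
    push_cast at hn
    by_cases h1 : 4 * (a * b - f ^ 2) < 3 * a ^ 2
    · obtain ⟨k, hk1, hk2⟩ := exists_balanced_add_mul f a ha
      have hsq : 4 * (f + k * a) ^ 2 ≤ a ^ 2 := by nlinarith
      have key : a * (b + 2 * k * f + k ^ 2 * a) = (a * b - f ^ 2) + (f + k * a) ^ 2 := by ring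
      have hb : 0 < b + 2 * k * f + k ^ 2 * a := by
        refine pos_of_mul_pos_right (a := a) ?_ ha.le
        rw [key]; positivity
      have hlt : b + 2 * k * f + k ^ 2 * a < a := by
        refine lt_of_mul_lt_mul_left (a := a) ?_ ha.le
        rw [key]; nlinarith
      obtain ⟨u, v, w, h⟩ := ih (b + 2 * k * f + k ^ 2 * a) a c e (d + k * e) (f + k * a) hb
        (by linarith) (by linear_combination hdet) (by linarith) y (x - k * y) z
      exact ⟨u, v, w, by rw [← h]; ring⟩
    by_cases h2 : 4 * a < 3 * (a * b - f ^ 2) ^ 2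
    · set C := a * b - f ^ 2 with hCdef
      obtain ⟨k, hk1, hk2⟩ := exists_balanced_add_mul (a * d - e * f) C hC
      have hsq : 4 * (a * d - e * f + k * C) ^ 2 ≤ C ^ 2 := by nlinarith
      have key : C * (a * (c + 2 * k * d + k ^ 2 * b) - (e + k * f) ^ 2)
          = a + (a * d - e * f + k * C) ^ 2 := by
        rw [hCdef]; linear_combination a * hdet
      have hb : 0 < a * (c + 2 * k * d + k ^ 2 * b) - (e + k * f) ^ 2 := by
        refine pos_of_mul_pos_right (a := C) ?_ hC.le
        rw [key]; positivity
      have hlt : a * (c + 2 * k * d + k ^ 2 * b) - (e + k * f) ^ 2 < C := by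
        refine lt_of_mul_lt_mul_left (a := C) ?_ hC.le
        rw [key]; nlinarith
      obtain ⟨u, v, w, h⟩ := ih a (c + 2 * k * d + k ^ 2 * b) b (d + k * b) f (e + k * f) ha
        hb (by linear_combination hdet) (by linarith) x z (y - k * z)
      exact ⟨u, v, w, by rw [← h]; ring⟩
    push Not at h1 h2
    have ha1 : a = 1 := by
      by_contra hne
      have h3 : 2 ≤ a := by omega
      nlinarith [mul_le_mul_of_nonneg_left h1 (by positivity : 0 ≤ a), mul_pos ha hC,
        mul_le_mul h3 h3 (by norm_num) ha.le]
    subst ha1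
    have hC1 : b = 1 + f ^ 2 := by nlinarith
    refine ⟨x + f * y + e * z, y + (d - e * f) * z, z, ?_⟩
    subst hC1
    linear_combination z ^ 2 * hdet

section

open Quaternion

/-- The Lipschitz quaternion with the given coordinates. -/
def Quaternion.ofCoords (a b c d : ℤ) : ℍ[ℤ] := ⟨a, b, c, d⟩

@[simp] theorem Quaternion.re_ofCoords (a b c d : ℤ) : (ofCoords a b c d).re = a := rfl
@[simp] theorem Quaternion.imI_ofCoords (a b c d : ℤ) : (ofCoords a b c d).imI = b := rfl
@[simp] theorem Quaternion.imJ_ofCoords (a b c d : ℤ) : (ofCoords a b c d).imJ = c := rfl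
@[simp] theorem Quaternion.imK_ofCoords (a b c d : ℤ) : (ofCoords a b c d).imK = d := rfl

theorem Quaternion.exists_eq_add_intCast_mul (ρ : ℍ[ℤ]) (m : ℤ) (hm : 0 < m) (hodd : Odd m) :
    ∃ σ κ : ℍ[ℤ], ρ = σ + (m : ℍ[ℤ]) * κ ∧ normSq σ < m ^ 2 := by
  have key : ∀ f : ℤ, ∃ r k : ℤ, f = r + m * k ∧ 4 * r ^ 2 < m ^ 2 := by
    intro f
    obtain ⟨l, rfl⟩ := hodd
    refine ⟨(f + l) % (2 * l + 1) - l, (f + l) / (2 * l + 1), ?_, ?_⟩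
    · linarith [Int.emod_add_mul_ediv (f + l) (2 * l + 1)]
    · have h1 := Int.emod_nonneg (f + l) hm.ne'
      have h2 := Int.emod_lt_of_pos (f + l) hm
      nlinarith
  obtain ⟨a, a', ha, ha2⟩ := key ρ.re
  obtain ⟨b, b', hb, hb2⟩ := key ρ.imI
  obtain ⟨c, c', hc, hc2⟩ := key ρ.imJ
  obtain ⟨d, d', hd, hd2⟩ := key ρ.imK
  refine ⟨ofCoords a b c d, ofCoords a' b' c' d', ?_, ?_⟩
  · ext <;> simp [*]
  · rw [Quaternion.normSq_def']
    simp only [re_ofCoords, imI_ofCoords, imJ_ofCoords, imK_ofCoords]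
    linarith

theorem Quaternion.normSq_intCast_mul (m : ℤ) (ρ : ℍ[ℤ]) :
    normSq ((m : ℍ[ℤ]) * ρ) = m ^ 2 * normSq ρ := by
  rw [map_mul, Quaternion.normSq_intCast, Int.cast_id]

theorem Quaternion.intCast_dvd_mul_of_isCoprime {p m : ℤ} (h : IsCoprime p m) {γ ρ : ℍ[ℤ]}
    (hd : (p : ℍ[ℤ]) ∣ γ * ((m : ℍ[ℤ]) * ρ)) : (p : ℍ[ℤ]) ∣ γ * ρ := by
  obtain ⟨u, v, huv⟩ := h
  obtain ⟨δ, hδ⟩ := hd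
  refine ⟨u * (γ * ρ) + v * δ, ?_⟩
  have h1 : ((u * p + v * m : ℤ) : ℍ[ℤ]) = 1 := by rw [huv]; simp
  push_cast at h1
  have c1 : γ * ((m : ℍ[ℤ]) * ρ) = m * (γ * ρ) := by
    rw [← mul_assoc, ← Int.cast_comm, mul_assoc]
  rw [c1] at hδ
  calc γ * ρ = (u * p + v * m : ℍ[ℤ]) * (γ * ρ) := by rw [h1, one_mul]
    _ = u * p * (γ * ρ) + v * (m * (γ * ρ)) := by noncomm_ring
    _ = p * (u * (γ * ρ)) + v * (p * δ) := by
      rw [hδ, (Int.cast_commute u (p : ℍ[ℤ])).eq, mul_assoc]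
    _ = _ := by
      rw [← mul_assoc (v : ℍ[ℤ]), (Int.cast_commute v (p : ℍ[ℤ])).eq, mul_assoc, mul_add]

theorem Quaternion.exists_mul_eq_two_mul (ρ : ℍ[ℤ]) (h : Even (normSq ρ)) :
    ∃ τ ρ' : ℍ[ℤ], normSq τ = 2 ∧ ρ * τ = ((2 : ℤ) : ℍ[ℤ]) * ρ' := by
  obtain ⟨a, b, c, d, rfl⟩ : ∃ a b c d, ρ = ofCoords a b c d := ⟨_, _, _, _, rfl⟩
  rw [Quaternion.normSq_def'] at h
  simp only [re_ofCoords, imI_ofCoords, imJ_ofCoords, imK_ofCoords, Int.even_add,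
    Int.even_pow, ne_eq, OfNat.ofNat_ne_zero, not_false_eq_true,
    and_true] at h
  by_cases hab : Even (a + b)
  · have hcd : Even (c + d) := by grind [Int.even_add]
    obtain ⟨s, hs⟩ := hab
    obtain ⟨r, hr⟩ := hcd
    refine ⟨ofCoords 1 1 0 0, ofCoords (s - b) s r (r - c), by simp [Quaternion.normSq_def'], ?_⟩
    ext <;> simp [-Int.cast_ofNat] <;> linarith
  by_cases hac : Even (a + c)
  · have hbd : Even (b + d) := by grind [Int.even_add]
    obtain ⟨s, hs⟩ := hac
    obtain ⟨r, hr⟩ := hbd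
    refine ⟨ofCoords 1 0 1 0, ofCoords (s - c) (r - d) s r, by simp [Quaternion.normSq_def'], ?_⟩
    ext <;> simp [-Int.cast_ofNat] <;> linarith
  · have had : Even (a + d) := by grind [Int.even_add]
    have hbc : Even (b + c) := by grind [Int.even_add]
    obtain ⟨s, hs⟩ := had
    obtain ⟨r, hr⟩ := hbc
    refine ⟨ofCoords 1 0 0 1, ofCoords (s - d) r (r - b) s, by simp [Quaternion.normSq_def'], ?_⟩
    ext <;> simp [-Int.cast_ofNat] <;> linarith

theorem Quaternion.exists_normSq_eq_prime_of_lt_s15 {p : ℕ} (hp : p.Prime) (γ : ℍ[ℤ]) (m : ℕ) :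
    0 < m → m < p → ∀ ρ : ℍ[ℤ], ((p : ℤ) : ℍ[ℤ]) ∣ γ * ρ → normSq ρ = m * p →
      ∃ ρ' : ℍ[ℤ], ((p : ℤ) : ℍ[ℤ]) ∣ γ * ρ' ∧ normSq ρ' = p := by
  induction m using Nat.strong_induction_on with
  | _ m ih =>
  intro hm hmp ρ hdvd hN
  have hm0 : (0 : ℤ) < m := by exact_mod_cast hm
  have hp0 : (0 : ℤ) < p := by exact_mod_cast hp.pos
  obtain rfl | hm1 := eq_or_ne m 1
  · exact ⟨ρ, hdvd, by simpa using hN⟩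
  have hcop : ∀ k : ℕ, 0 < k → k < p → IsCoprime (p : ℤ) (k : ℤ) := fun k hk hkp =>
    Nat.isCoprime_iff_coprime.mpr (Nat.coprime_of_lt_prime hk.ne' hkp hp)
  obtain ⟨l, rfl⟩ | hodd := Nat.even_or_odd m
  · obtain ⟨τ, ρ', hτ, hρ'⟩ := Quaternion.exists_mul_eq_two_mul ρ
      (by rw [hN]; push_cast; exact ⟨l * p, by ring⟩)
    refine ih l (by omega) (by omega) (by omega) ρ' ?_ ?_
    · refine Quaternion.intCast_dvd_mul_of_isCoprime (hcop 2 (by norm_num) (by omega)) ?_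
      push_cast at hρ' ⊢
      rw [← hρ', ← mul_assoc]
      exact_mod_cast Dvd.dvd.mul_right hdvd τ
    · have := congrArg normSq hρ'
      rw [map_mul, hτ, hN, Quaternion.normSq_intCast_mul] at this
      push_cast at this
      linarith
  · obtain ⟨σ, κ, hσ, hlt⟩ := Quaternion.exists_eq_add_intCast_mul ρ m hm0 (by exact_mod_cast hodd)
    have hσm : (m : ℤ) ∣ normSq σ := by
      have h1 : σ = ρ - ((m : ℤ) : ℍ[ℤ]) * κ := by rw [hσ]; abel
      refine ⟨p - 2 * (ρ * star κ).re + m * normSq κ, ?_⟩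
      have h2 : normSq σ = normSq ρ - 2 * m * (ρ * star κ).re + m ^ 2 * normSq κ := by
        rw [h1]
        simp only [Quaternion.normSq_def']
        simp
        ring
      rw [h2, hN]; ring
    obtain ⟨r, hr⟩ := hσm
    have hr0 : 0 ≤ r := by
      have := Quaternion.normSq_nonneg (a := σ)
      rw [hr] at this
      exact nonneg_of_mul_nonneg_right this hm0
    have hrm : r < m := by
      rw [hr] at hlt
      nlinarith
    have hrne : r ≠ 0 := by
      rintro rfl
      rw [mul_zero, Quaternion.normSq_eq_zero] at hr
      rw [hr, zero_add] at hσ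
      rw [hσ, Quaternion.normSq_intCast_mul] at hN
      have : (m : ℤ) ∣ p := ⟨normSq κ, by
        apply mul_left_cancel₀ hm0.ne'; linarith⟩
      rcases (Nat.dvd_prime hp).mp (by exact_mod_cast this) with h | h <;> omega
    lift r to ℕ using hr0
    have hmul : ρ * star σ = ((m : ℤ) : ℍ[ℤ]) * (r + κ * star σ) := by
      conv_lhs => rw [hσ]
      rw [add_mul, Quaternion.self_mul_star, hr, mul_add, mul_assoc]
      congr 1
      ext <;> simp
    refine ih r (by exact_mod_cast hrm) (by omega) (by omega) (r + κ * star σ) ?_ ?_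
    · refine Quaternion.intCast_dvd_mul_of_isCoprime (hcop m hm hmp) ?_
      rw [← hmul, ← mul_assoc]
      exact Dvd.dvd.mul_right hdvd _
    · have := congrArg normSq hmul
      rw [map_mul, Quaternion.normSq_star, hN, hr, Quaternion.normSq_intCast_mul] at this
      apply mul_left_cancel₀ (pow_ne_zero 2 hm0.ne')
      linarith

/-- Rotating by a quaternion of prime norm `p ≡ 3 [MOD 4]` interchanges the representations of `N`
with `y` and `z` divisible by four and those with `y` and `z` twice an odd number. -/
theorem exists_sum_three_squares_type_change {p : ℕ} (hp : p.Prime) (hp4 : p % 4 = 3)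
    {x y z t : ℤ} (hx : Odd x) (hy : 4 ∣ y) (hz : 4 ∣ z)
    (hN : ¬ (p : ℤ) ∣ x ^ 2 + y ^ 2 + z ^ 2) (ht : (p : ℤ) ∣ t ^ 2 + (x ^ 2 + y ^ 2 + z ^ 2)) :
    ∃ x' y' z' : ℤ, x' ^ 2 + y' ^ 2 + z' ^ 2 = x ^ 2 + y ^ 2 + z ^ 2 ∧
      Odd x' ∧ y' % 4 = 2 ∧ z' % 4 = 2 := by
  have hp0 : (0 : ℤ) < p := by exact_mod_cast hp.pos
  obtain ⟨s, hs⟩ := ht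
  obtain ⟨σ, κ, hσ, hlt⟩ := Quaternion.exists_eq_add_intCast_mul (ofCoords t x y z) p hp0
    (by rw [Int.odd_iff]; omega)
  have h0 := congrArg QuaternionAlgebra.re hσ
  have h1 := congrArg QuaternionAlgebra.imI hσ
  have h2 := congrArg QuaternionAlgebra.imJ hσ
  have h3 := congrArg QuaternionAlgebra.imK hσ
  simp at h0 h1 h2 h3
  have hdvdN : (p : ℤ) ∣ normSq σ := by
    rw [Quaternion.normSq_def']
    refine ⟨s - 2 * (t * κ.re + x * κ.imI + y * κ.imJ + z * κ.imK)
      + p * (κ.re ^ 2 + κ.imI ^ 2 + κ.imJ ^ 2 + κ.imK ^ 2), ?_⟩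
    have e0 : σ.re = t - p * κ.re := by linarith
    have e1 : σ.imI = x - p * κ.imI := by linarith
    have e2 : σ.imJ = y - p * κ.imJ := by linarith
    have e3 : σ.imK = z - p * κ.imK := by linarith
    rw [e0, e1, e2, e3]
    linear_combination hs
  obtain ⟨m, hm⟩ := hdvdN
  have hm0 : 0 ≤ m := by
    have := Quaternion.normSq_nonneg (a := σ)
    rw [hm] at this
    exact nonneg_of_mul_nonneg_right this hp0
  have hmp : m < p := by
    rw [hm] at hlt
    nlinarith
  have hmne : m ≠ 0 := by
    rintro rfl
    rw [mul_zero, Quaternion.normSq_eq_zero] at hm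
    subst hm
    simp at h1 h2 h3
    apply hN
    rw [h1, h2, h3]
    exact ⟨p * (κ.imI ^ 2 + κ.imJ ^ 2 + κ.imK ^ 2), by ring⟩
  lift m to ℕ using hm0
  have hdvd : ((p : ℤ) : ℍ[ℤ]) ∣ (ofCoords (-t) x y z) * σ := by
    have e : σ = (ofCoords t x y z) - ((p : ℤ) : ℍ[ℤ]) * κ := by rw [hσ]; abel
    have e2 : (ofCoords (-t) x y z) * (ofCoords t x y z) = 
      ((p : ℤ) : ℍ[ℤ]) * ((-s : ℤ) : ℍ[ℤ]) := by
      rw [← Int.cast_mul]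
      ext <;> simp <;> linarith
    rw [e, mul_sub, e2, ← mul_assoc, ← Int.cast_comm (p : ℤ) (ofCoords _ _ _ _),
      mul_assoc, ← mul_sub]
    exact Dvd.intro _ rfl
  obtain ⟨ρ, ⟨δ, hδ⟩, hρ⟩ := Quaternion.exists_normSq_eq_prime_of_lt_s15 hp
    (ofCoords (-t) x y z) m (by omega) (by omega) σ hdvd (by rw [hm]; ring)
  rw [Quaternion.normSq_def'] at hρ
  have g0 := congrArg QuaternionAlgebra.re hδ
  have g1 := congrArg QuaternionAlgebra.imI hδ
  have g2 := congrArg QuaternionAlgebra.imJ hδ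
  have g3 := congrArg QuaternionAlgebra.imK hδ
  simp at g0 g1 g2 g3
  generalize δ.re = a', δ.imI = b', δ.imJ = c', δ.imK = d' at g0 g1 g2 g3
  generalize ρ.re = a, ρ.imI = b, ρ.imJ = c, ρ.imK = d at hρ g0 g1 g2 g3
  have f1 : p * (a * b' - b * a' - c * d' + d * c') = x * (a ^ 2 + b ^ 2 - c ^ 2 - d ^ 2)
      + 2 * y * (b * c + a * d) + 2 * z * (b * d - a * c) := by
    linear_combination -a * g1 + b * g0 + c * g3 - d * g2
  have f2 : p * (a * c' - c * a' - d * b' + b * d') = y * (a ^ 2 - b ^ 2 + c ^ 2 - d ^ 2)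
      + 2 * x * (b * c - a * d) + 2 * z * (c * d + a * b) := by
    linear_combination -a * g2 + c * g0 + d * g1 - b * g3
  have f3 : p * (a * d' - d * a' - b * c' + c * b') = z * (a ^ 2 - b ^ 2 - c ^ 2 + d ^ 2)
      + 2 * x * (b * d + a * c) + 2 * y * (c * d - a * b) := by
    linear_combination -a * g3 + d * g0 + b * g2 - c * g1
  generalize a * b' - b * a' - c * d' + d * c' = x' at f1
  generalize a * c' - c * a' - d * b' + b * d' = y' at f2
  generalize a * d' - d * a' - b * c' + c * b' = z' at f3
  have key : ∀ w l : ℤ, Odd l → 4 ∣ p * w - 2 * l → w % 4 = 2 := by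
    intro w l hl hd
    have hp' : (p : ℤ) = 4 * (p / 4) + 3 := by omega
    rw [hp', show (4 * ((p : ℤ) / 4) + 3) * w = 4 * ((p / 4) * w) + 3 * w by ring] at hd
    rw [Int.odd_iff] at hl
    omega
  have hparity : Odd (b * c - a * d) ∧ Odd (b * d + a * c) := by
    have hsq : ∀ w : ℤ, Even w ∧ w ^ 2 % 4 = 0 ∨ ¬ Even w ∧ w ^ 2 % 4 = 1 := by
      intro w
      rcases Int.even_or_odd w with h | h
      · exact .inl ⟨h, by obtain ⟨l, rfl⟩ := h; ring_nf; omega⟩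
      · exact .inr ⟨by simpa using h, by obtain ⟨l, rfl⟩ := h; ring_nf; omega⟩
    simp only [← Int.not_even_iff_odd, Int.even_add, Int.even_sub, Int.even_mul]
    rcases hsq a with ⟨ha, ha'⟩ | ⟨ha, ha'⟩ <;> rcases hsq b with ⟨hb, hb'⟩ | ⟨hb, hb'⟩ <;>
    rcases hsq c with ⟨hc, hc'⟩ | ⟨hc, hc'⟩ <;> rcases hsq d with ⟨hd, hd'⟩ | ⟨hd, hd'⟩ <;>
    first
    | (exfalso; omega)
    | simp [ha, hb, hc, hd]
  obtain ⟨odd1, odd2⟩ := hparity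
  refine ⟨x', y', z', ?_, ?_, ?_, ?_⟩
  · apply mul_left_cancel₀ (pow_ne_zero 2 hp0.ne')
    have : (p : ℤ) ^ 2 * (x' ^ 2 + y' ^ 2 + z' ^ 2)
        = (p * x') ^ 2 + (p * y') ^ 2 + (p * z') ^ 2 := by ring
    rw [this, f1, f2, f3, ← hρ]
    ring
  · have h : Odd (p * x') := by
      rw [f1]
      have : Odd (a ^ 2 + b ^ 2 - c ^ 2 - d ^ 2) := by
        rw [show a ^ 2 + b ^ 2 - c ^ 2 - d ^ 2 = p - 2 * (c ^ 2 + d ^ 2) by rw [← hρ]; ring]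
        rw [Int.odd_iff]
        omega
      have := hx.mul this
      obtain ⟨l, hl⟩ := this
      exact ⟨l + y * (b * c + a * d) + z * (b * d - a * c), by rw [hl]; ring⟩
    exact (Int.odd_mul.mp h).2
  · refine key y' _ (hx.mul odd1) ?_
    obtain ⟨y, rfl⟩ := hy
    obtain ⟨z, rfl⟩ := hz
    exact ⟨y * (a ^ 2 - b ^ 2 + c ^ 2 - d ^ 2) + 2 * z * (c * d + a * b),
      by linear_combination f2⟩
  · refine key z' _ (hx.mul odd2) ?_
    obtain ⟨y, rfl⟩ := hy
    obtain ⟨z, rfl⟩ := hz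
    exact ⟨z * (a ^ 2 - b ^ 2 - c ^ 2 + d ^ 2) + 2 * y * (c * d - a * b),
      by linear_combination f3⟩

end

section

open NumberTheorySymbols

/-- The three-square theorem for integers congruent to one modulo eight. -/
theorem Nat.exists_sum_three_squares_of_mod_eight_eq_one {m : ℕ} (hm : m % 8 = 1) :
    ∃ x y z : ℤ, x ^ 2 + y ^ 2 + z ^ 2 = m := by
  have hcop : ((3 * m - 1) / 2).Coprime (4 * m) := by
    obtain ⟨l, rfl⟩ : ∃ l, m = 8 * l + 1 := ⟨m / 8, by omega⟩
    rw [show (3 * (8 * l + 1) - 1) / 2 = 12 * l + 1 by omega]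
    rw [← Nat.isCoprime_iff_coprime]
    push_cast
    exact ⟨1 + 24 * l, -9 * l, by ring⟩
  obtain ⟨p, hpm, hp, hpmod⟩ := Nat.forall_exists_prime_gt_and_modEq (3 * m) (by omega) hcop
  obtain ⟨j, hj⟩ : ∃ j : ℕ, p = 4 * m * j + (3 * m - 1) / 2 := by
    obtain ⟨j, hj⟩ := (Nat.modEq_iff_dvd' (by omega)).mp hpmod.symm
    exact ⟨j, by omega⟩
  have hd : 2 * p + 1 = (8 * j + 3) * m := by
    have : 2 * ((3 * m - 1) / 2) + 1 = 3 * m := by omega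
    rw [hj]; linarith
  have hp4 : p % 4 = 1 := by
    rw [hj, mul_assoc]; omega
  have := Fact.mk hp
  have hpd : J(p | 8 * j + 3) = 1 := by
    have h1 : J(2 * p | 8 * j + 3) = J(-1 | 8 * j + 3) := by
      apply jacobiSym.mod_left'
      apply Int.ModEq.symm
      rw [Int.modEq_iff_dvd]
      exact ⟨m, by push_cast; exact_mod_cast (by linarith : (2 * p - -1 : ℤ) = (8 * j + 3) * m)⟩
    have hodd : Odd (8 * j + 3) := by rw [Nat.odd_iff]; omega
    rw [jacobiSym.mul_left, jacobiSym.at_two hodd, jacobiSym.at_neg_one hodd,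
      ZMod.χ₈_nat_mod_eight, ZMod.χ₄_nat_three_mod_four (by omega),
      show (8 * j + 3) % 8 = 3 by omega] at h1
    have : ZMod.χ₈ (3 : ℕ) = -1 := by decide
    rw [this] at h1
    linarith
  have hdp : J(-((8 * j + 3 : ℕ) : ℤ) | p) = 1 := by
    rw [jacobiSym.neg _ (by rw [Nat.odd_iff]; omega), ZMod.χ₄_nat_one_mod_four hp4, one_mul,
      jacobiSym.quadratic_reciprocity_one_mod_four' (by rw [Nat.odd_iff]; omega) hp4, hpd]
  obtain ⟨s, hs2, hs⟩ : ∃ s : ℤ, Odd s ∧ (p : ℤ) ∣ s ^ 2 + (8 * j + 3) := by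
    obtain ⟨r, hr⟩ := ZMod.isSquare_of_jacobiSym_eq_one hdp
    have h : (p : ℤ) ∣ (r.val : ℤ) ^ 2 + (8 * j + 3) := by
      rw [← ZMod.intCast_zmod_eq_zero_iff_dvd]
      push_cast at hr ⊢
      rw [ZMod.natCast_zmod_val]
      linear_combination -hr
    rcases Int.even_or_odd (r.val : ℤ) with he | ho
    · refine ⟨r.val + p, he.add_odd (by rw [Int.odd_iff]; omega), ?_⟩
      obtain ⟨k, hk⟩ := h
      exact ⟨k + 2 * r.val + p, by linear_combination hk⟩
    · exact ⟨_, ho, h⟩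
  obtain ⟨a, ha⟩ : (2 * p : ℤ) ∣ s ^ 2 + (8 * j + 3) := by
    refine IsCoprime.mul_dvd ?_ ?_ hs
    · rw [Int.isCoprime_iff_gcd_eq_one]
      have := (Nat.coprime_primes Nat.prime_two hp).mpr (by omega)
      exact_mod_cast this
    · obtain ⟨k, rfl⟩ := hs2
      exact ⟨2 * k ^ 2 + 2 * k + 4 * j + 2, by ring⟩
  have hp0 : (0 : ℤ) < p := by exact_mod_cast hp.pos
  have ha0 : 0 < a := by
    refine pos_of_mul_pos_right (a := 2 * (p : ℤ)) ?_ (by positivity)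
    rw [← ha]; positivity
  zify at hd
  obtain ⟨u, v, w, h⟩ := exists_sum_three_squares_of_det_eq_one
    (a + (a * (2 * p) - s ^ 2)).toNat a (2 * p) m 0 1 s ha0
    (by linarith) (by linear_combination (-m : ℤ) * ha - hd) (Int.self_le_toNat _) 0 0 1
  exact ⟨u, v, w, by rw [← h]; ring⟩

theorem Nat.exists_prime_mod_four_eq_three_and_jacobiSym_eq_neg_one {N : ℕ} (hN : N % 8 = 1)
    (hsq : ¬ IsSquare N) : ∃ p : ℕ, p.Prime ∧ p % 4 = 3 ∧ J(N | p) = -1 := by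
  obtain ⟨s, t, hs0, ht0, hst, hs⟩ := Nat.sq_mul_squarefree_of_pos (n := N) (by omega)
  have hs1 : s ≠ 1 := by
    rintro rfl
    exact hsq ⟨t, by rw [← hst]; ring⟩
  obtain ⟨q, hq, k, rfl⟩ := Nat.exists_prime_and_dvd hs1
  have := Fact.mk hq
  have hodd : Odd (t ^ 2 * (q * k)) := by rw [hst, Nat.odd_iff]; omega
  have hqk : q.Coprime k := (Nat.squarefree_mul_iff.mp hs).1
  simp only [Nat.odd_mul] at hodd
  obtain ⟨hot, hoq, hok⟩ := hodd
  have hq4 : q.Coprime 4 := (Nat.coprime_pow_right_iff (by norm_num : 0 < 2) q 2).mpr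
    hoq.coprime_two_right
  have hk4 : k.Coprime 4 := (Nat.coprime_pow_right_iff (by norm_num : 0 < 2) k 2).mpr
    hok.coprime_two_right
  obtain ⟨r, hr⟩ := FiniteField.exists_nonsquare (F := ZMod q)
    (by rw [ZMod.ringChar_zmod_n]; rintro rfl; exact absurd hoq (by decide))
  obtain ⟨n₁, hn₁q, hn₁k⟩ := Nat.chineseRemainder hqk r.val 1
  obtain ⟨n, hnqk, hn4⟩ := Nat.chineseRemainder (Nat.Coprime.mul_left hq4 hk4) n₁ 3
  have hnq : n ≡ r.val [MOD q] := (hnqk.of_mul_right k).trans hn₁q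
  have hnk : n ≡ 1 [MOD k] := (hnqk.of_mul_left q).trans hn₁k
  have hncop : n.Coprime (q * k * 4) := by
    refine Nat.Coprime.mul_right (Nat.Coprime.mul_right ?_ ?_) ?_
    · refine Nat.Coprime.symm ((Nat.Prime.coprime_iff_not_dvd hq).mpr fun h => hr ?_)
      have : r = 0 := by
        rw [← ZMod.natCast_zmod_val r, ZMod.natCast_eq_zero_iff]
        exact (hnq.dvd_iff dvd_rfl).mp h
      exact this ▸ IsSquare.zero
    · rw [Nat.Coprime, hnk.gcd_eq]; simp
    · rw [Nat.Coprime, hn4.gcd_eq]; rfl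
  obtain ⟨p, hpN, hp, hpn⟩ := Nat.forall_exists_prime_gt_and_modEq N
    (by have := hq.pos; have := hok.pos; positivity) hncop
  have hp4 : p % 4 = 3 := (hpn.of_mul_left (q * k)).trans hn4
  refine ⟨p, hp, hp4, ?_⟩
  rw [jacobiSym.quadratic_reciprocity_one_mod_four (by omega) (by rw [Nat.odd_iff]; omega), ← hst,
    jacobiSym.mul_right' _ (by positivity) hs.ne_zero,
    jacobiSym.mul_right' _ hq.ne_zero hok.pos.ne', jacobiSym.pow_right]
  have htp : (p : ℤ).gcd t = 1 := by
    rw [Int.gcd_natCast_natCast]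
    refine Nat.coprime_of_lt_prime ht0.ne' (lt_of_le_of_lt ?_ hpN) hp
    have := hq.pos
    have := hok.pos
    rw [← hst]
    nlinarith [Nat.mul_pos hq.pos hok.pos]
  have hJk : J(p | k) = 1 := by
    rw [jacobiSym.mod_left' (a₂ := 1), jacobiSym.one_left]
    exact_mod_cast ((hpn.of_mul_right 4).of_mul_left q).trans hnk
  have hJq : J(p | q) = -1 := by
    refine ZMod.nonsquare_iff_jacobiSym_eq_neg_one.mpr ?_
    have : ((p : ℕ) : ZMod q) = r := by
      rw [← ZMod.natCast_zmod_val r, ZMod.natCast_eq_natCast_iff]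
      exact ((hpn.of_mul_right 4).of_mul_right k).trans hnq
    simpa [this] using hr
  rw [jacobiSym.sq_one htp, hJk, hJq]
  norm_num

end

theorem exists_sum_three_squares_of_dvd_of_mod_four_eq_three {M p : ℕ} (hM : Odd M)
    (hp4 : p % 4 = 3) (hpM : p ∣ M) : ∃ x y z : ℤ, x ^ 2 + y ^ 2 + z ^ 2 = (M : ℤ) ^ 2 ∧
      Odd x ∧ y % 4 = 2 ∧ z % 4 = 2 := by
  obtain ⟨k, rfl⟩ := hpM
  obtain ⟨a, b, c, d, h⟩ := Nat.sum_four_squares p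
  zify at h
  have hk : Odd (k : ℤ) := by exact_mod_cast (Nat.odd_mul.mp hM).2
  /- Two of the four squares can be chosen with bases of the same parity. -/
  obtain ⟨u, v, w, r, hu⟩ : ∃ u v w r : ℤ, u ^ 2 + v ^ 2 + 2 * (w ^ 2 + r ^ 2) = p := by
    have key : ∀ a b c d : ℤ, a ^ 2 + b ^ 2 + c ^ 2 + d ^ 2 = p → Even (c + d) →
        ∃ u v w r : ℤ, u ^ 2 + v ^ 2 + 2 * (w ^ 2 + r ^ 2) = p := by
      rintro a b c d h ⟨l, hl⟩
      obtain rfl : d = l + l - c := by linarith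
      exact ⟨a, b, l, l - c, by rw [← h]; ring⟩
    by_cases h1 : Even ((c : ℤ) + d)
    · exact key _ _ _ _ h h1
    by_cases h2 : Even ((b : ℤ) + c)
    · exact key a d b c (by linarith) h2
    · exact key a c b d (by linarith) (by grind [Int.even_add])
  have hsq : ∀ w : ℤ, w ^ 2 % 4 = 0 ∨ w ^ 2 % 4 = 1 := by
    intro w
    rcases Int.even_or_odd' w with ⟨l, rfl | rfl⟩
    · left; ring_nf; omega
    · right; ring_nf; omega
  have hs : (w ^ 2 + r ^ 2) % 4 = 1 ∧ (u ^ 2 + v ^ 2) % 4 = 1 := by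
    rcases hsq u with h1 | h1 <;> rcases hsq v with h2 | h2 <;> rcases hsq w with h3 | h3 <;>
      rcases hsq r with h4 | h4 <;> omega
  obtain ⟨hs1, hs2⟩ := hs
  /- The product of the two sums of two squares is a sum `e ^ 2 + g ^ 2`. -/
  obtain ⟨e, g, heg⟩ : ∃ e g : ℤ, e ^ 2 + g ^ 2 = (w ^ 2 + r ^ 2) * (u ^ 2 + v ^ 2) :=
    ⟨u * w + v * r, u * r - v * w, by ring⟩
  generalize w ^ 2 + r ^ 2 = s at *
  generalize u ^ 2 + v ^ 2 = t at *
  have hst : (e ^ 2 + g ^ 2) % 4 = 1 := by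
    rw [heg, Int.mul_emod, hs1, hs2]; rfl
  have hodd : Odd (e + g) := by
    rw [← Int.not_even_iff_odd]
    rintro ⟨l, hl⟩
    obtain rfl : g = l + l - e := by linarith
    have : e ^ 2 + (l + l - e) ^ 2 = 2 * (e ^ 2 + 2 * l ^ 2 - 2 * l * e) := by ring
    omega
  have hodd' : Odd (e - g) := by
    rw [show e - g = e + g - 2 * g by ring]; exact hodd.sub_even (even_two_mul g)
  have hmod : ∀ q : ℤ, Odd q → (k * (2 * q)) % 4 = 2 := by
    intro q hq
    obtain ⟨l, hl⟩ := hk.mul hq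
    rw [show (k : ℤ) * (2 * q) = 2 * (k * q) by ring, hl]
    omega
  refine ⟨k * (t - 2 * s), k * (2 * (e + g)), k * (2 * (e - g)), ?_, ?_, hmod _ hodd,
    hmod _ hodd'⟩
  · push_cast
    rw [← hu]
    linear_combination 8 * k ^ 2 * heg
  · refine hk.mul ?_
    rw [Int.odd_iff]; omega

theorem Nat.mod_four_eq_one_of_forall_prime {M : ℕ}
    (hM : ∀ p : ℕ, p.Prime → p ∣ M → p % 4 = 1) : M % 4 = 1 := by
  induction M using induction_on_primes with
  | zero => exact absurd (hM 2 Nat.prime_two (dvd_zero 2)) (by norm_num)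
  | one => rfl
  | prime_mul p k hp ih =>
    rw [Nat.mul_mod, hM p hp (dvd_mul_right p k),
      ih fun q hq hqk => hM q hq (hqk.mul_left p)]

/-- If every prime factor of `M` is congruent to one modulo four, then `M ^ 2` has no
representation of the given kind. -/
theorem sum_three_squares_ne_sq_of_forall_prime_mod_four_eq_one {M : ℕ}
    (hM : ∀ p : ℕ, p.Prime → p ∣ M → p % 4 = 1)
    {x y z : ℤ} (hx : Odd x) (hy : y % 4 = 2)
    (hz : z % 4 = 2) : x ^ 2 + y ^ 2 + z ^ 2 ≠ (M : ℤ) ^ 2 := by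
  have hM1 := Nat.mod_four_eq_one_of_forall_prime hM
  intro h
  wlog hxM : (M - x) % 4 = 0 generalizing x
  · refine this (x := -x) hx.neg (by rw [← h]; ring) ?_
    rw [Int.odd_iff] at hx
    omega
  obtain ⟨b, rfl⟩ : ∃ b, y = 4 * b + 2 := ⟨y / 4, by omega⟩
  obtain ⟨c, rfl⟩ : ∃ c, z = 4 * c + 2 := ⟨z / 4, by omega⟩
  obtain ⟨s, hs⟩ : ∃ s, (M - x) = 4 * s := ⟨(M - x) / 4, by omega⟩
  obtain rfl : x = M - 4 * s := by linarith
  set t := (M : ℤ) - 2 * s with ht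
  have hst : s * t = (b + c + 1) ^ 2 + (b - c) ^ 2 := by
    rw [ht]; linarith
  have hst0 : 0 < s * t := by
    rcases eq_or_ne (b - c) 0 with h0 | h0
    · have : b + c + 1 ≠ 0 := by omega
      rw [hst]; positivity
    · rw [hst]; positivity
  have hstM : 0 < 2 * s + t := by rw [ht]; omega
  have hs0 : 0 < s := by
    by_contra hle
    nlinarith
  have ht0 : 0 < t := pos_of_mul_pos_right hst0 hs0.le
  have hst4 : s * t % 4 = 1 := by
    rw [hst, show (b + c + 1) ^ 2 + (b - c) ^ 2 = 2 * (b ^ 2 + b + c ^ 2 + c) + 1 by ring]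
    have h1 := Int.even_mul_succ_self b
    have h2 := Int.even_mul_succ_self c
    obtain ⟨k, hk⟩ := h1.add h2
    rw [show b ^ 2 + b + c ^ 2 + c = b * (b + 1) + c * (c + 1) by ring, hk]
    omega
  have hs4 : s % 4 = 3 := by
    have hM4 : (2 * s + t) % 4 = 1 := by rw [ht]; omega
    have h1 : s % 4 = 0 ∨ s % 4 = 1 ∨ s % 4 = 2 ∨ s % 4 = 3 := by omega
    rw [Int.mul_emod] at hst4
    rcases h1 with h1 | h1 | h1 | h1
    · rw [h1] at hst4; omega
    · rw [h1] at hst4; omega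
    · rw [h1] at hst4; omega
    · exact h1
  clear_value t
  lift s to ℕ using hs0.le
  lift t to ℕ using ht0.le
  have hs0' : s ≠ 0 := by omega
  have ht0' : t ≠ 0 := by omega
  have hsum : ∃ e g : ℕ, s * t = e ^ 2 + g ^ 2 := by
    refine ⟨(b + c + 1).natAbs, (b - c).natAbs, ?_⟩
    zify
    rw [hst, sq_abs, sq_abs]
  have hns : ¬ ∃ e g : ℕ, s = e ^ 2 + g ^ 2 := by
    rintro ⟨e, g, rfl⟩
    have h1 : ∀ w : ℕ, w ^ 2 % 4 = 0 ∨ w ^ 2 % 4 = 1 := by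
      intro w
      rcases Nat.even_or_odd' w with ⟨l, rfl | rfl⟩
      · left; ring_nf; omega
      · right; ring_nf; omega
    have := h1 e
    have := h1 g
    omega
  rw [Nat.eq_sq_add_sq_iff] at hsum hns
  push Not at hns
  obtain ⟨q, hq, hq4, hqs⟩ := hns
  have hqp := Nat.prime_of_mem_primeFactors hq
  have := Fact.mk hqp
  have hdvd := Nat.dvd_of_mem_primeFactors hq
  have hev := hsum q (Nat.mem_primeFactors.mpr ⟨hqp, hdvd.mul_right t, mul_ne_zero hs0' ht0'⟩) hq4
  rw [padicValNat.mul hs0' ht0', Nat.even_add] at hev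
  have hqt : q ∣ t := by
    by_contra hnd
    rw [padicValNat.eq_zero_of_not_dvd hnd] at hev
    exact hqs (hev.mpr (by simp))
  have hMst : M = 2 * s + t := by omega
  have := hM q hqp (hMst ▸ (hdvd.mul_left 2).add hqt)
  omega

theorem exists_sum_three_squares_of_not_isSquare {N : ℕ} (hN : N % 8 = 1) (hsq : ¬ IsSquare N) :
    ∃ x y z : ℤ, x ^ 2 + y ^ 2 + z ^ 2 = N ∧ Odd x ∧ y % 4 = 2 ∧ z % 4 = 2 := by
  have hsq8 : ∀ w : ℤ, w % 2 = 1 ∧ w ^ 2 % 8 = 1 ∨ w % 4 = 2 ∧ w ^ 2 % 8 = 4 ∨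
      4 ∣ w ∧ w ^ 2 % 8 = 0 := by
    intro w
    obtain ⟨l, hl⟩ : ∃ l, w = 4 * l ∨ w = 4 * l + 1 ∨ w = 4 * l + 2 ∨ w = 4 * l + 3 :=
      ⟨w / 4, by omega⟩
    rcases hl with rfl | rfl | rfl | rfl
    · right; right; exact ⟨⟨l, rfl⟩, by ring_nf; omega⟩
    · left; exact ⟨by omega, by ring_nf; omega⟩
    · right; left; exact ⟨by omega, by ring_nf; omega⟩
    · left; exact ⟨by omega, by ring_nf; omega⟩
  obtain ⟨x, y, z, h, hx⟩ : ∃ x y z : ℤ, x ^ 2 + y ^ 2 + z ^ 2 = N ∧ Odd x := by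
    obtain ⟨x, y, z, h⟩ := Nat.exists_sum_three_squares_of_mod_eight_eq_one hN
    by_cases hx : Odd x
    · exact ⟨x, y, z, h, hx⟩
    by_cases hy : Odd y
    · exact ⟨y, x, z, by linarith, hy⟩
    by_cases hz : Odd z
    · exact ⟨z, x, y, by linarith, hz⟩
    rw [Int.odd_iff] at hx hy hz
    have := hsq8 x
    have := hsq8 y
    have := hsq8 z
    omega
  have hyz : y % 4 = 2 ∧ z % 4 = 2 ∨ 4 ∣ y ∧ 4 ∣ z := by
    have h1 := hsq8 x
    rw [Int.odd_iff] at hx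
    have := hsq8 y
    have := hsq8 z
    omega
  rcases hyz with ⟨hy, hz⟩ | ⟨hy, hz⟩
  · exact ⟨x, y, z, h, hx, hy, hz⟩
  obtain ⟨p, hp, hp4, hJ⟩ := Nat.exists_prime_mod_four_eq_three_and_jacobiSym_eq_neg_one hN hsq
  have := Fact.mk hp
  have hJ' : jacobiSym (-N) p = 1 := by
    rw [jacobiSym.neg _ (by rw [Nat.odd_iff]; omega), hJ, ZMod.χ₄_nat_three_mod_four hp4]
    norm_num
  obtain ⟨r, hr⟩ := ZMod.isSquare_of_jacobiSym_eq_one hJ'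
  rw [← h]
  refine exists_sum_three_squares_type_change hp hp4 (t := r.val) hx hy hz ?_ ?_
  · rw [h, ← ZMod.intCast_zmod_eq_zero_iff_dvd]
    intro h0
    exact ZMod.nonsquare_of_jacobiSym_eq_neg_one hJ (h0 ▸ IsSquare.zero)
  · rw [h, ← ZMod.intCast_zmod_eq_zero_iff_dvd]
    push_cast at hr ⊢
    rw [ZMod.natCast_zmod_val]
    linear_combination -hr

theorem finite_setOf_sum_three_squares_eq (N : ℤ) :
    {v : ℤ × ℤ × ℤ | v.1 ^ 2 + v.2.1 ^ 2 + v.2.2 ^ 2 = N}.Finite := by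
  refine ((Set.finite_Icc (-N) N).prod
    ((Set.finite_Icc (-N) N).prod (Set.finite_Icc (-N) N))).subset ?_
  rintro ⟨x, y, z⟩ h
  simp only [Set.mem_ofPred_eq] at h
  have key : ∀ w : ℤ, w ^ 2 ≤ N → w ∈ Set.Icc (-N) N := by
    intro w hw
    have h1 : w ≤ w ^ 2 := Int.le_self_sq w
    have h2 : -w ≤ (-w) ^ 2 := Int.le_self_sq (-w)
    rw [neg_sq] at h2
    exact ⟨by linarith, by linarith⟩
  have hx := sq_nonneg x
  have hy := sq_nonneg y
  have hz := sq_nonneg z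
  exact ⟨key x (by linarith), key y (by linarith), key z (by linarith)⟩


theorem stmt_15 (n : ℕ) (hn : 0 < n) :
    Nat.card {v : ℤ × ℤ × ℤ //
        v.1 ^ 2 + v.2.1 ^ 2 + v.2.2 ^ 2 = 8 * (n : ℤ) + 1 ∧
        v.1 ≡ 1 [ZMOD 2] ∧ v.2.1 ≡ 2 [ZMOD 4] ∧ v.2.2 ≡ 2 [ZMOD 4]} = 0 ↔
      ∃ M : ℕ, 0 < M ∧ 8 * n + 1 = M ^ 2 ∧ ∀ p : ℕ, p.Prime → p ∣ M → p % 4 = 1 := by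
  have hfin : Finite {v : ℤ × ℤ × ℤ //
      v.1 ^ 2 + v.2.1 ^ 2 + v.2.2 ^ 2 = 8 * (n : ℤ) + 1 ∧
      v.1 ≡ 1 [ZMOD 2] ∧ v.2.1 ≡ 2 [ZMOD 4] ∧ v.2.2 ≡ 2 [ZMOD 4]} :=
    ((finite_setOf_sum_three_squares_eq (8 * n + 1)).subset fun _ hv => hv.1).to_subtype
  rw [Finite.card_eq_zero_iff, isEmpty_subtype]
  constructor
  · intro h
    have hno : ∀ x y z : ℤ, Odd x → y % 4 = 2 → z % 4 = 2 →
        x ^ 2 + y ^ 2 + z ^ 2 ≠ ((8 * n + 1 : ℕ) : ℤ) := fun x y z hx hy hz hsum =>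
      h (x, y, z) ⟨by exact_mod_cast hsum, Int.odd_iff.mp hx, hy, hz⟩
    by_cases hsq : IsSquare (8 * n + 1)
    · obtain ⟨M, hM⟩ := hsq
      rw [← sq] at hM
      have hMpos : 0 < M := by
        rw [Nat.pos_iff_ne_zero]
        rintro rfl
        omega
      refine ⟨M, hMpos, hM, fun p hp hpM => ?_⟩
      have hodd : Odd M := by
        rw [← Nat.odd_pow_iff two_ne_zero, ← hM, Nat.odd_iff]
        omega
      rcases Nat.odd_mod_four_iff.mp (Nat.odd_iff.mp (hodd.of_dvd_nat hpM)) with h1 | h3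
      · exact h1
      · obtain ⟨x, y, z, hs, hx, hy, hz⟩ :=
          exists_sum_three_squares_of_dvd_of_mod_four_eq_three hodd h3 hpM
        exact absurd (by rw [hs, hM]; push_cast; rfl) (hno x y z hx hy hz)
    · obtain ⟨x, y, z, hs, hx, hy, hz⟩ :=
        exists_sum_three_squares_of_not_isSquare (N := 8 * n + 1) (by omega) hsq
      exact absurd hs (hno x y z hx hy hz)
  · rintro ⟨M, -, hM, hp⟩ ⟨x, y, z⟩ ⟨h, hx, hy, hz⟩
    refine sum_three_squares_ne_sq_of_forall_prime_mod_four_eq_one hp (Int.odd_iff.mpr hx) hy hz ?_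
    rw [h]
    exact_mod_cast hM
end
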